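/- arXiv:2409.01697 — 3 statements merged into one kernel-verified Lean document; each statement's English description precedes it below -/
import Mathlib

section
/- A vector x* ∈ ℝⁿ is a strict local-nonglobal minimizer of (GTR) if and only if the following two conditions hold: (i) f₁(x*) = 0; (ii) there exists a multiplier μ* > 0 such that (A₀x* + b₀) + μ*(A₁x* + b₁) = 0, vᵀ(A₀ + μ*A₁)v > 0 for every nonzero v ∈ ℝⁿ with (A₁x* + b₁)ᵀv = 0, and A₀ + μ*A₁ is not positive semidefinite. -/
open Matrix Finset

/-- Euclidean norm of a vector in `Fin n → ℝ`. -/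
noncomputable def euclNorm {n : ℕ} (x : Fin n → ℝ) : ℝ := Real.sqrt (x ⬝ᵥ x)

/-- Objective `f₀(x) = xᵀA₀x + 2b₀ᵀx`. -/
noncomputable def qf0 {n : ℕ} (A0 : Matrix (Fin n) (Fin n) ℝ) (b0 : Fin n → ℝ)
    (x : Fin n → ℝ) : ℝ := x ⬝ᵥ A0.mulVec x + 2 * (b0 ⬝ᵥ x)

/-- Constraint `f₁(x) = xᵀA₁x + 2b₁ᵀx + c₁`. -/
noncomputable def qf1 {n : ℕ} (A1 : Matrix (Fin n) (Fin n) ℝ) (b1 : Fin n → ℝ) (c1 : ℝ)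
    (x : Fin n → ℝ) : ℝ := x ⬝ᵥ A1.mulVec x + 2 * (b1 ⬝ᵥ x) + c1

/-- Local minimizer of (GTRE): feasible, and locally optimal among feasible points. -/
def IsLocalMinGTRE {n : ℕ} (A0 A1 : Matrix (Fin n) (Fin n) ℝ) (b0 b1 : Fin n → ℝ) (c1 : ℝ)
    (xs : Fin n → ℝ) : Prop :=
  qf1 A1 b1 c1 xs = 0 ∧ ∃ δ > (0:ℝ), ∀ x : Fin n → ℝ,
    qf1 A1 b1 c1 x = 0 → euclNorm (x - xs) < δ → qf0 A0 b0 xs ≤ qf0 A0 b0 x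

/-- Global minimizer of (GTRE). -/
def IsGlobalMinGTRE {n : ℕ} (A0 A1 : Matrix (Fin n) (Fin n) ℝ) (b0 b1 : Fin n → ℝ) (c1 : ℝ)
    (xs : Fin n → ℝ) : Prop :=
  qf1 A1 b1 c1 xs = 0 ∧ ∀ x : Fin n → ℝ, qf1 A1 b1 c1 x = 0 → qf0 A0 b0 xs ≤ qf0 A0 b0 x

/-- Local-nonglobal minimizer of (GTRE). -/
def IsLNGMinGTRE {n : ℕ} (A0 A1 : Matrix (Fin n) (Fin n) ℝ) (b0 b1 : Fin n → ℝ) (c1 : ℝ)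
    (xs : Fin n → ℝ) : Prop :=
  IsLocalMinGTRE A0 A1 b0 b1 c1 xs ∧ ¬ IsGlobalMinGTRE A0 A1 b0 b1 c1 xs

/-- Strict local minimizer of (GTRE). -/
def IsStrictLocalMinGTRE {n : ℕ} (A0 A1 : Matrix (Fin n) (Fin n) ℝ) (b0 b1 : Fin n → ℝ)
    (c1 : ℝ) (xs : Fin n → ℝ) : Prop :=
  qf1 A1 b1 c1 xs = 0 ∧ ∃ δ > (0:ℝ), ∀ x : Fin n → ℝ,
    qf1 A1 b1 c1 x = 0 → x ≠ xs → euclNorm (x - xs) < δ → qf0 A0 b0 xs < qf0 A0 b0 x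

/-- Strict local-nonglobal minimizer of (GTRE). -/
def IsStrictLNGMinGTRE {n : ℕ} (A0 A1 : Matrix (Fin n) (Fin n) ℝ) (b0 b1 : Fin n → ℝ)
    (c1 : ℝ) (xs : Fin n → ℝ) : Prop :=
  IsStrictLocalMinGTRE A0 A1 b0 b1 c1 xs ∧ ¬ IsGlobalMinGTRE A0 A1 b0 b1 c1 xs

/-- Local minimizer of (GTR). -/
def IsLocalMinGTR {n : ℕ} (A0 A1 : Matrix (Fin n) (Fin n) ℝ) (b0 b1 : Fin n → ℝ) (c1 : ℝ)
    (xs : Fin n → ℝ) : Prop :=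
  qf1 A1 b1 c1 xs ≤ 0 ∧ ∃ δ > (0:ℝ), ∀ x : Fin n → ℝ,
    qf1 A1 b1 c1 x ≤ 0 → euclNorm (x - xs) < δ → qf0 A0 b0 xs ≤ qf0 A0 b0 x

/-- Global minimizer of (GTR). -/
def IsGlobalMinGTR {n : ℕ} (A0 A1 : Matrix (Fin n) (Fin n) ℝ) (b0 b1 : Fin n → ℝ) (c1 : ℝ)
    (xs : Fin n → ℝ) : Prop :=
  qf1 A1 b1 c1 xs ≤ 0 ∧ ∀ x : Fin n → ℝ, qf1 A1 b1 c1 x ≤ 0 → qf0 A0 b0 xs ≤ qf0 A0 b0 x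

/-- Local-nonglobal minimizer of (GTR). -/
def IsLNGMinGTR {n : ℕ} (A0 A1 : Matrix (Fin n) (Fin n) ℝ) (b0 b1 : Fin n → ℝ) (c1 : ℝ)
    (xs : Fin n → ℝ) : Prop :=
  IsLocalMinGTR A0 A1 b0 b1 c1 xs ∧ ¬ IsGlobalMinGTR A0 A1 b0 b1 c1 xs

/-- Strict local minimizer of (GTR). -/
def IsStrictLocalMinGTR {n : ℕ} (A0 A1 : Matrix (Fin n) (Fin n) ℝ) (b0 b1 : Fin n → ℝ)
    (c1 : ℝ) (xs : Fin n → ℝ) : Prop :=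
  qf1 A1 b1 c1 xs ≤ 0 ∧ ∃ δ > (0:ℝ), ∀ x : Fin n → ℝ,
    qf1 A1 b1 c1 x ≤ 0 → x ≠ xs → euclNorm (x - xs) < δ → qf0 A0 b0 xs < qf0 A0 b0 x

/-- Strict local-nonglobal minimizer of (GTR). -/
def IsStrictLNGMinGTR {n : ℕ} (A0 A1 : Matrix (Fin n) (Fin n) ℝ) (b0 b1 : Fin n → ℝ)
    (c1 : ℝ) (xs : Fin n → ℝ) : Prop :=
  IsStrictLocalMinGTR A0 A1 b0 b1 c1 xs ∧ ¬ IsGlobalMinGTR A0 A1 b0 b1 c1 xs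

open Filter Topology

section QuadraticModel

variable {n : ℕ}

theorem Matrix.IsSymm.dotProduct_mulVec_comm {A : Matrix (Fin n) (Fin n) ℝ} (hA : A.IsSymm)
    (u v : Fin n → ℝ) : u ⬝ᵥ A.mulVec v = v ⬝ᵥ A.mulVec u := by
  rw [dotProduct_mulVec, ← mulVec_transpose, hA.eq, dotProduct_comm]

theorem Matrix.IsSymm.quadForm_add_smul {A : Matrix (Fin n) (Fin n) ℝ} (hA : A.IsSymm)
    (u v : Fin n → ℝ) (t : ℝ) :
    (u + t • v) ⬝ᵥ A.mulVec (u + t • v)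
      = u ⬝ᵥ A.mulVec u + 2 * t * (u ⬝ᵥ A.mulVec v) + t ^ 2 * (v ⬝ᵥ A.mulVec v) := by
  simp only [mulVec_add, mulVec_smul, add_dotProduct, dotProduct_add, smul_dotProduct,
    dotProduct_smul, smul_eq_mul, hA.dotProduct_mulVec_comm v u]
  ring

theorem quadForm_smul (A : Matrix (Fin n) (Fin n) ℝ) (v : Fin n → ℝ) (t : ℝ) :
    (t • v) ⬝ᵥ A.mulVec (t • v) = t ^ 2 * (v ⬝ᵥ A.mulVec v) := by
  simp only [mulVec_smul, smul_dotProduct, dotProduct_smul, smul_eq_mul]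
  ring

theorem quadForm_add_smul_matrix (A B : Matrix (Fin n) (Fin n) ℝ) (μ : ℝ) (v : Fin n → ℝ) :
    v ⬝ᵥ (A + μ • B).mulVec v = v ⬝ᵥ A.mulVec v + μ * (v ⬝ᵥ B.mulVec v) := by
  simp only [add_mulVec, smul_mulVec, dotProduct_add, dotProduct_smul, smul_eq_mul]

theorem qf0_add {A : Matrix (Fin n) (Fin n) ℝ} (hA : A.IsSymm) (b x d : Fin n → ℝ) :
    qf0 A b (x + d) = qf0 A b x + (2 * ((A.mulVec x + b) ⬝ᵥ d) + d ⬝ᵥ A.mulVec d) := by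
  have h := hA.quadForm_add_smul x d 1
  have h' := hA.dotProduct_mulVec_comm x d
  rw [one_smul] at h
  simp only [qf0, h, h', dotProduct_add, add_dotProduct, dotProduct_comm (A.mulVec x) d]
  ring

theorem qf1_add {A : Matrix (Fin n) (Fin n) ℝ} (hA : A.IsSymm) (b : Fin n → ℝ) (c : ℝ)
    (x d : Fin n → ℝ) :
    qf1 A b c (x + d) = qf1 A b c x + 2 * ((A.mulVec x + b) ⬝ᵥ d) + d ⬝ᵥ A.mulVec d := by
  have h := qf0_add hA b x d
  simp only [qf0] at h
  simp only [qf1]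
  linarith

theorem continuous_euclNorm : Continuous (euclNorm (n := n)) := by
  unfold euclNorm
  fun_prop

theorem euclNorm_smul (t : ℝ) (v : Fin n → ℝ) : euclNorm (t • v) = |t| * euclNorm v := by
  simp only [euclNorm, smul_dotProduct, dotProduct_smul, smul_eq_mul]
  rw [← mul_assoc, Real.sqrt_mul (mul_self_nonneg t), Real.sqrt_mul_self_eq_abs]

theorem dotProduct_self_eq_euclNorm_sq (v : Fin n → ℝ) : v ⬝ᵥ v = euclNorm v ^ 2 := by
  rw [euclNorm, Real.sq_sqrt]
  exact Finset.sum_nonneg fun i _ => mul_self_nonneg (v i)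

theorem dotProduct_self_pos {v : Fin n → ℝ} (hv : v ≠ 0) : 0 < v ⬝ᵥ v :=
  lt_of_le_of_ne (Finset.sum_nonneg fun i _ => mul_self_nonneg (v i))
    fun h => hv (dotProduct_self_eq_zero.1 h.symm)

theorem euclNorm_pos {v : Fin n → ℝ} (hv : v ≠ 0) : 0 < euclNorm v :=
  Real.sqrt_pos.2 (dotProduct_self_pos hv)

theorem dotProduct_mulVec_eq_sum (A : Matrix (Fin n) (Fin n) ℝ) (v : Fin n → ℝ) :
    v ⬝ᵥ A.mulVec v = ∑ i, ∑ j, A i j * (v i * v j) := by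
  simp only [dotProduct, mulVec, Finset.mul_sum]
  exact Finset.sum_congr rfl fun i _ => Finset.sum_congr rfl fun j _ => by ring

theorem abs_dotProduct_le (u v : Fin n → ℝ) : |u ⬝ᵥ v| ≤ euclNorm u * euclNorm v := by
  refine abs_le_of_sq_le_sq ?_ (mul_nonneg (Real.sqrt_nonneg _) (Real.sqrt_nonneg _))
  rw [mul_pow, ← dotProduct_self_eq_euclNorm_sq, ← dotProduct_self_eq_euclNorm_sq]
  simpa only [dotProduct, sq] using Finset.sum_mul_sq_le_sq_mul_sq Finset.univ u v

theorem exists_abs_quadForm_le (A : Matrix (Fin n) (Fin n) ℝ) :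
    ∃ C : ℝ, 0 ≤ C ∧ ∀ v : Fin n → ℝ, |v ⬝ᵥ A.mulVec v| ≤ C * (v ⬝ᵥ v) := by
  refine ⟨∑ i, ∑ j, |A i j|, by positivity, fun v => ?_⟩
  have hle : ∀ i, v i ^ 2 ≤ v ⬝ᵥ v := fun i => by
    rw [sq]
    exact Finset.single_le_sum (f := fun i => v i * v i) (fun i _ => mul_self_nonneg (v i))
      (Finset.mem_univ i)
  simp only [dotProduct_mulVec_eq_sum, Finset.sum_mul]
  refine (Finset.abs_sum_le_sum_abs _ _).trans (Finset.sum_le_sum fun i _ => ?_)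
  refine (Finset.abs_sum_le_sum_abs _ _).trans (Finset.sum_le_sum fun j _ => ?_)
  rw [abs_mul]
  refine mul_le_mul_of_nonneg_left (abs_le.2 ⟨?_, ?_⟩) (abs_nonneg _)
  · nlinarith [hle i, hle j, sq_nonneg (v i + v j)]
  · nlinarith [hle i, hle j, sq_nonneg (v i - v j)]

/-- The increment `d ↦ 2g₀ᵀd + dᵀA₀d` is positive at every small nonzero `d` with
`c + 2gᵀd + dᵀA₁d ≤ 0`. -/
def StrictMinIncrement (A0 A1 : Matrix (Fin n) (Fin n) ℝ) (g0 g : Fin n → ℝ) (c δ : ℝ) : Prop :=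
  ∀ d : Fin n → ℝ, d ≠ 0 → euclNorm d < δ → c + 2 * (g ⬝ᵥ d) + d ⬝ᵥ A1.mulVec d ≤ 0 →
    0 < 2 * (g0 ⬝ᵥ d) + d ⬝ᵥ A0.mulVec d

theorem isStrictLocalMinGTR_iff {A0 A1 : Matrix (Fin n) (Fin n) ℝ} (hA0 : A0.IsSymm)
    (hA1 : A1.IsSymm) (b0 b1 : Fin n → ℝ) (c1 : ℝ) (xs : Fin n → ℝ) :
    IsStrictLocalMinGTR A0 A1 b0 b1 c1 xs ↔ qf1 A1 b1 c1 xs ≤ 0 ∧ ∃ δ > (0 : ℝ),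
      StrictMinIncrement A0 A1 (A0.mulVec xs + b0) (A1.mulVec xs + b1) (qf1 A1 b1 c1 xs) δ := by
  refine and_congr_right fun _ => exists_congr fun δ => and_congr_right fun _ => ⟨?_, ?_⟩
  · intro h d hd hn hf
    have := h (xs + d) (by rwa [qf1_add hA1]) (by simpa using hd) (by simpa using hn)
    rw [qf0_add hA0] at this
    linarith
  · intro h x hf hx hn
    have e : x = xs + (x - xs) := by abel
    rw [e, qf1_add hA1] at hf
    have := h (x - xs) (sub_ne_zero.2 hx) hn hf
    rw [e, qf0_add hA0]
    linarith

namespace StrictMinIncrement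

variable {A0 A1 : Matrix (Fin n) (Fin n) ℝ} {g0 g : Fin n → ℝ} {c δ μ : ℝ}

theorem eventually_pos (h : StrictMinIncrement A0 A1 g0 g c δ) (hδ : 0 < δ) {d : Fin n → ℝ}
    (hd : d ≠ 0)
    (hf : ∀ᶠ t : ℝ in 𝓝[>] 0, c + 2 * t * (g ⬝ᵥ d) + t ^ 2 * (d ⬝ᵥ A1.mulVec d) ≤ 0) :
    ∀ᶠ t : ℝ in 𝓝[>] 0, 0 < 2 * (g0 ⬝ᵥ d) + t * (d ⬝ᵥ A0.mulVec d) := by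
  have hn : ∀ᶠ t : ℝ in 𝓝[>] 0, euclNorm (t • d) < δ := by
    have hc : Continuous fun t : ℝ => euclNorm (t • d) := continuous_euclNorm.comp (by fun_prop)
    have := hc.tendsto 0
    rw [euclNorm_smul, abs_zero, zero_mul] at this
    exact (this.eventually_lt_const hδ).filter_mono nhdsWithin_le_nhds
  filter_upwards [hf, hn, self_mem_nhdsWithin] with t h1 h2 (h3 : 0 < t)
  have := h (t • d) (smul_ne_zero h3.ne' hd) h2
    (by rw [quadForm_smul, dotProduct_smul, smul_eq_mul]; linarith)
  rw [quadForm_smul, dotProduct_smul, smul_eq_mul] at this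
  refine pos_of_mul_pos_right (a := t) ?_ h3.le
  linarith

theorem dotProduct_nonneg (h : StrictMinIncrement A0 A1 g0 g c δ) (hδ : 0 < δ) {d : Fin n → ℝ}
    (hf : ∀ᶠ t : ℝ in 𝓝[>] 0, c + 2 * t * (g ⬝ᵥ d) + t ^ 2 * (d ⬝ᵥ A1.mulVec d) ≤ 0) :
    0 ≤ g0 ⬝ᵥ d := by
  rcases eq_or_ne d 0 with rfl | hd
  · simp
  have hc : Continuous fun t : ℝ => 2 * (g0 ⬝ᵥ d) + t * (d ⬝ᵥ A0.mulVec d) := by fun_prop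
  have := ge_of_tendsto ((hc.tendsto 0).mono_left nhdsWithin_le_nhds)
    ((h.eventually_pos hδ hd hf).mono fun _ h => h.le)
  linarith

theorem increment_nonneg_of_line (h : StrictMinIncrement A0 A1 g0 g c δ) (hδ : 0 < δ)
    {d : Fin n → ℝ}
    (hf : ∀ᶠ t : ℝ in 𝓝 0, c + 2 * t * (g ⬝ᵥ d) + t ^ 2 * (d ⬝ᵥ A1.mulVec d) ≤ 0) :
    0 ≤ 2 * (g0 ⬝ᵥ d) + d ⬝ᵥ A0.mulVec d := by
  rcases eq_or_ne d 0 with rfl | hd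
  · simp
  have h1 := h.dotProduct_nonneg hδ (hf.filter_mono nhdsWithin_le_nhds)
  have h2 : 0 ≤ g0 ⬝ᵥ (-d) := by
    refine h.dotProduct_nonneg hδ (Eventually.filter_mono nhdsWithin_le_nhds ?_)
    have hneg : Tendsto (fun t : ℝ => -t) (𝓝 0) (𝓝 0) := by
      simpa using (continuous_neg (G := ℝ)).tendsto 0
    filter_upwards [hneg.eventually hf] with t ht
    simp only [mulVec_neg, dotProduct_neg, neg_dotProduct] at ht ⊢
    linarith
  rw [dotProduct_neg] at h2
  have h0 : g0 ⬝ᵥ d = 0 := by linarith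
  obtain ⟨t, ht, ht0⟩ := ((h.eventually_pos hδ hd (hf.filter_mono nhdsWithin_le_nhds)).and
    self_mem_nhdsWithin).exists
  rw [h0] at ht ⊢
  have : 0 < d ⬝ᵥ A0.mulVec d :=
    pos_of_mul_pos_right (a := t) (by linarith) (le_of_lt ht0)
  linarith

theorem eventually_feasible_of_neg {d : Fin n → ℝ} (hd : g ⬝ᵥ d < 0) :
    ∀ᶠ t : ℝ in 𝓝[>] 0, 0 + 2 * t * (g ⬝ᵥ d) + t ^ 2 * (d ⬝ᵥ A1.mulVec d) ≤ 0 := by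
  have hc : Continuous fun t : ℝ => 2 * (g ⬝ᵥ d) + t * (d ⬝ᵥ A1.mulVec d) := by fun_prop
  have h0 : ∀ᶠ t : ℝ in 𝓝[>] 0, 2 * (g ⬝ᵥ d) + t * (d ⬝ᵥ A1.mulVec d) < 0 :=
    ((hc.tendsto 0).eventually_lt_const (by linarith)).filter_mono nhdsWithin_le_nhds
  filter_upwards [h0, self_mem_nhdsWithin] with t h1 (h2 : 0 < t)
  nlinarith

theorem exists_multiplier (h : StrictMinIncrement A0 A1 g0 g 0 δ) (hδ : 0 < δ) (hg : g ≠ 0) :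
    ∃ μ : ℝ, 0 ≤ μ ∧ g0 + μ • g = 0 := by
  have hgg := dotProduct_self_pos hg
  have key : ∀ d, g ⬝ᵥ d < 0 → 0 ≤ g0 ⬝ᵥ d := fun d hd =>
    h.dotProduct_nonneg hδ (eventually_feasible_of_neg hd)
  obtain ⟨m, hm⟩ : ∃ m, m * (g ⬝ᵥ g) = -(g0 ⬝ᵥ g) :=
    ⟨-(g0 ⬝ᵥ g) / (g ⬝ᵥ g), div_mul_cancel₀ _ hgg.ne'⟩
  refine ⟨m, ?_, ?_⟩
  · have := key (-g) (by rw [dotProduct_neg]; linarith)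
    rw [dotProduct_neg] at this
    nlinarith
  · by_contra hp
    have hpp := dotProduct_self_pos hp
    have hgp : g ⬝ᵥ (g0 + m • g) = 0 := by
      rw [dotProduct_add, dotProduct_smul, smul_eq_mul, dotProduct_comm g g0]
      linarith
    have hgp' : g0 ⬝ᵥ (g0 + m • g) = (g0 + m • g) ⬝ᵥ (g0 + m • g) := by
      conv_rhs => rw [add_dotProduct, smul_dotProduct, hgp]
      simp
    set p := g0 + m • g
    have hev : ∀ᶠ e : ℝ in 𝓝[>] 0, 0 ≤ -(p ⬝ᵥ p) - e * (g0 ⬝ᵥ g) := by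
      filter_upwards [self_mem_nhdsWithin] with e (he : 0 < e)
      have := key (-p - e • g) (by
        rw [dotProduct_sub, dotProduct_neg, dotProduct_smul, smul_eq_mul, hgp]; nlinarith)
      rwa [dotProduct_sub, dotProduct_neg, dotProduct_smul, smul_eq_mul, hgp'] at this
    have hc : Continuous fun e : ℝ => -(p ⬝ᵥ p) - e * (g0 ⬝ᵥ g) := by fun_prop
    have := ge_of_tendsto ((hc.tendsto 0).mono_left nhdsWithin_le_nhds) hev
    linarith

/-- The chord in direction `u` to the second boundary point cannot be short when the Lagrangian
has nonpositive curvature along `u`. -/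
theorem le_abs_mul_euclNorm (h : StrictMinIncrement A0 A1 g0 g 0 δ) (hμ : g0 + μ • g = 0)
    {u : Fin n → ℝ} (hu : u ⬝ᵥ (A0 + μ • A1).mulVec u ≤ 0) (h1 : u ⬝ᵥ A1.mulVec u ≠ 0)
    (hgu : g ⬝ᵥ u ≠ 0) :
    δ ≤ |-(2 * (g ⬝ᵥ u)) / (u ⬝ᵥ A1.mulVec u)| * euclNorm u := by
  by_contra! hlt
  obtain ⟨t, ht⟩ : ∃ t, t = -(2 * (g ⬝ᵥ u)) / (u ⬝ᵥ A1.mulVec u) := ⟨_, rfl⟩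
  have htu : t * (u ⬝ᵥ A1.mulVec u) = -(2 * (g ⬝ᵥ u)) := by rw [ht, div_mul_cancel₀ _ h1]
  have ht0 : t ≠ 0 := by
    rw [ht]; exact div_ne_zero (by simpa using hgu) h1
  have hu0 : u ≠ 0 := by rintro rfl; simp at hgu
  have hg0 : g0 ⬝ᵥ u = -μ * (g ⬝ᵥ u) := by
    rw [eq_neg_of_add_eq_zero_left hμ, neg_dotProduct, smul_dotProduct, smul_eq_mul, neg_mul]
  rw [← ht, ← euclNorm_smul] at hlt
  have := h (t • u) (smul_ne_zero ht0 hu0) hlt (by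
    rw [quadForm_smul, dotProduct_smul, smul_eq_mul, sq, mul_assoc, htu]; linarith)
  rw [quadForm_smul, dotProduct_smul, smul_eq_mul, hg0] at this
  rw [quadForm_add_smul_matrix] at hu
  have e : t ^ 2 * (u ⬝ᵥ A0.mulVec u)
      = t ^ 2 * (u ⬝ᵥ A0.mulVec u + μ * (u ⬝ᵥ A1.mulVec u)) + 2 * t * μ * (g ⬝ᵥ u) := by
    linear_combination (-t * μ) * htu
  nlinarith [mul_nonneg (sq_nonneg t) (neg_nonneg.2 hu)]

theorem not_curve (h : StrictMinIncrement A0 A1 g0 g 0 δ) (hδ : 0 < δ) (hμ : g0 + μ • g = 0)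
    {v p : Fin n → ℝ} (hgv : g ⬝ᵥ v = 0) (h1 : v ⬝ᵥ A1.mulVec v ≠ 0) (hgp : g ⬝ᵥ p ≠ 0) :
    ¬ ∀ᶠ e : ℝ in 𝓝[>] 0, (v + e • p) ⬝ᵥ (A0 + μ • A1).mulVec (v + e • p) ≤ 0 := by
  intro hcurv
  have hc : ContinuousAt (fun e : ℝ => |-(2 * (g ⬝ᵥ (v + e • p))) /
      ((v + e • p) ⬝ᵥ A1.mulVec (v + e • p))| * euclNorm (v + e • p)) 0 := by
    refine ContinuousAt.mul (ContinuousAt.abs (ContinuousAt.div ?_ ?_ (by simpa using h1)))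
      (continuous_euclNorm.comp (by fun_prop)).continuousAt <;> fun_prop
  have hq : ContinuousAt (fun e : ℝ => (v + e • p) ⬝ᵥ A1.mulVec (v + e • p)) 0 := by fun_prop
  have hne := (hq.eventually_ne (by simpa using h1)).filter_mono
    (nhdsWithin_le_nhds (s := Set.Ioi (0 : ℝ)))
  have := ge_of_tendsto (hc.tendsto.mono_left (nhdsWithin_le_nhds (s := Set.Ioi (0 : ℝ)))) (by
    filter_upwards [hcurv, hne, self_mem_nhdsWithin] with e h2 h3 (h4 : 0 < e)
    refine h.le_abs_mul_euclNorm hμ h2 h3 ?_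
    rw [dotProduct_add, dotProduct_smul, hgv, zero_add, smul_eq_mul]
    exact mul_ne_zero h4.ne' hgp)
  simp only [zero_smul, add_zero, hgv, mul_zero, neg_zero, zero_div, abs_zero, zero_mul] at this
  linarith

theorem not_of_feasible_line (h : StrictMinIncrement A0 A1 g0 g 0 δ) (hδ : 0 < δ)
    (hμ : g0 + μ • g = 0) {v : Fin n → ℝ} (hv : v ≠ 0) (hgv : g ⬝ᵥ v = 0)
    (h1 : v ⬝ᵥ A1.mulVec v = 0) : 0 < v ⬝ᵥ (A0 + μ • A1).mulVec v := by
  obtain ⟨t, ht, ht0⟩ := ((h.eventually_pos hδ hv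
    (Eventually.of_forall fun t => by simp [hgv, h1])).and self_mem_nhdsWithin).exists
  have hg0 : g0 ⬝ᵥ v = 0 := by
    rw [eq_neg_of_add_eq_zero_left hμ, neg_dotProduct, smul_dotProduct, hgv]; simp
  rw [hg0] at ht
  rw [quadForm_add_smul_matrix, h1, mul_zero, add_zero]
  exact pos_of_mul_pos_right (a := t) (by linarith) (le_of_lt ht0)

theorem curvature_nonneg (h : StrictMinIncrement A0 A1 g0 g 0 δ) (hδ : 0 < δ)
    (hμ : g0 + μ • g = 0) (hg : g ≠ 0) {v : Fin n → ℝ} (hgv : g ⬝ᵥ v = 0) :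
    0 ≤ v ⬝ᵥ (A0 + μ • A1).mulVec v := by
  by_contra! hv
  have hv0 : v ≠ 0 := by rintro rfl; simp at hv
  by_cases h1 : v ⬝ᵥ A1.mulVec v = 0
  · exact hv.not_gt (h.not_of_feasible_line hδ hμ hv0 hgv h1)
  · refine h.not_curve hδ hμ hgv h1 (dotProduct_self_pos hg).ne' ?_
    have hq : Continuous
        fun e : ℝ => (v + e • g) ⬝ᵥ (A0 + μ • A1).mulVec (v + e • g) := by fun_prop
    exact (((hq.tendsto 0).eventually_lt_const (by simpa using hv)).mono
      fun _ h => h.le).filter_mono nhdsWithin_le_nhds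

theorem curvature_pos (h : StrictMinIncrement A0 A1 g0 g 0 δ) (hδ : 0 < δ)
    (hM : (A0 + μ • A1).IsSymm) (hμ : g0 + μ • g = 0) (hg : g ≠ 0)
    {w : Fin n → ℝ} (hw : w ⬝ᵥ (A0 + μ • A1).mulVec w < 0)
    {v : Fin n → ℝ} (hv0 : v ≠ 0) (hgv : g ⬝ᵥ v = 0) :
    0 < v ⬝ᵥ (A0 + μ • A1).mulVec v := by
  by_cases h1 : v ⬝ᵥ A1.mulVec v = 0
  · exact h.not_of_feasible_line hδ hμ hv0 hgv h1
  by_contra! hv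
  obtain ⟨p, hp, hvp⟩ : ∃ p, p ⬝ᵥ (A0 + μ • A1).mulVec p < 0 ∧
      v ⬝ᵥ (A0 + μ • A1).mulVec p ≤ 0 := by
    rcases le_total (v ⬝ᵥ (A0 + μ • A1).mulVec w) 0 with h' | h'
    · exact ⟨w, hw, h'⟩
    · exact ⟨-w, by simpa [mulVec_neg] using hw, by simpa [mulVec_neg] using h'⟩
  refine h.not_curve hδ hμ hgv h1
    (fun hgp => hp.not_ge (h.curvature_nonneg hδ hμ hg hgp)) ?_
  filter_upwards [self_mem_nhdsWithin] with e (he : 0 < e)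
  rw [hM.quadForm_add_smul]
  nlinarith [mul_nonneg he.le (neg_nonneg.2 hvp), mul_nonneg (sq_nonneg e) (neg_pos.2 hp).le]

theorem multiplier_pos (h : StrictMinIncrement A0 A1 g0 g 0 δ) (hδ : 0 < δ)
    (hμ0 : 0 ≤ μ) (hμ : g0 + μ • g = 0) (hg : g ≠ 0)
    {w : Fin n → ℝ} (hw : w ⬝ᵥ (A0 + μ • A1).mulVec w < 0) : 0 < μ := by
  refine lt_of_le_of_ne hμ0 ?_
  rintro rfl
  have hgw : g ⬝ᵥ w ≠ 0 := fun hgw => hw.not_ge (h.curvature_nonneg hδ hμ hg hgw)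
  simp only [zero_smul, add_zero] at hμ hw
  obtain ⟨p, hp, hgp⟩ : ∃ p, p ⬝ᵥ A0.mulVec p < 0 ∧ g ⬝ᵥ p < 0 := by
    rcases lt_or_gt_of_ne hgw with h' | h'
    · exact ⟨w, hw, h'⟩
    · exact ⟨-w, by simpa [mulVec_neg] using hw, by simpa using h'⟩
  have hp0 : p ≠ 0 := by rintro rfl; simp at hp
  obtain ⟨t, ht, ht0⟩ := ((h.eventually_pos hδ hp0 (eventually_feasible_of_neg hgp)).and
    self_mem_nhdsWithin).exists
  rw [hμ, zero_dotProduct] at ht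
  have : 0 < t := ht0
  nlinarith

end StrictMinIncrement

theorem isSymm_add_smul {A B : Matrix (Fin n) (Fin n) ℝ} (hA : A.IsSymm) (hB : B.IsSymm)
    (μ : ℝ) : (A + μ • B).IsSymm :=
  hA.add (hB.smul μ)

theorem Matrix.IsSymm.posSemidef_iff_quadForm_nonneg {A : Matrix (Fin n) (Fin n) ℝ}
    (hA : A.IsSymm) : A.PosSemidef ↔ ∀ v : Fin n → ℝ, 0 ≤ v ⬝ᵥ A.mulVec v := by
  rw [posSemidef_iff_dotProduct_mulVec]
  simp [hA]

/-- A quadratic form positive on the punctured hyperplane `gᵀv = 0` becomes positive definite after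
adding a large multiple of `(gᵀv)²`. -/
theorem exists_penalty (M : Matrix (Fin n) (Fin n) ℝ) (g : Fin n → ℝ)
    (hpos : ∀ v : Fin n → ℝ, v ≠ 0 → g ⬝ᵥ v = 0 → 0 < v ⬝ᵥ M.mulVec v) :
    ∃ σ : ℝ, 0 ≤ σ ∧ ∃ α > 0, ∀ v : Fin n → ℝ,
      α * (v ⬝ᵥ v) ≤ v ⬝ᵥ M.mulVec v + σ * (g ⬝ᵥ v) ^ 2 := by
  have hK : IsCompact (Metric.sphere (0 : Fin n → ℝ) 1) := isCompact_sphere _ _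
  obtain ⟨k, hk⟩ := hK.elim_directed_cover
    (fun k : ℕ => {v : Fin n → ℝ | 0 < v ⬝ᵥ M.mulVec v + k * (g ⬝ᵥ v) ^ 2})
    (fun k => isOpen_lt continuous_const (by fun_prop))
    (by
      intro v hv
      have hv0 : v ≠ 0 := by rintro rfl; simp at hv
      rw [Set.mem_iUnion]
      by_cases hgv : g ⬝ᵥ v = 0
      · exact ⟨0, by simpa using hpos v hv0 hgv⟩
      · have h2 : 0 < (g ⬝ᵥ v) ^ 2 := by positivity
        obtain ⟨k, hk⟩ := exists_nat_gt (-(v ⬝ᵥ M.mulVec v) / (g ⬝ᵥ v) ^ 2)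
        rw [div_lt_iff₀ h2] at hk
        exact ⟨k, show 0 < v ⬝ᵥ M.mulVec v + k * (g ⬝ᵥ v) ^ 2 by linarith⟩)
    (directed_of_isDirected_le fun i j hij v hv => by
      have : (i : ℝ) ≤ j := by exact_mod_cast hij
      have hv' : 0 < v ⬝ᵥ M.mulVec v + i * (g ⬝ᵥ v) ^ 2 := hv
      change 0 < v ⬝ᵥ M.mulVec v + j * (g ⬝ᵥ v) ^ 2
      nlinarith [sq_nonneg (g ⬝ᵥ v)])
  refine ⟨k, Nat.cast_nonneg k, ?_⟩
  have hcont : ContinuousOn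
      (fun v : Fin n → ℝ => (v ⬝ᵥ M.mulVec v + k * (g ⬝ᵥ v) ^ 2) / (v ⬝ᵥ v))
      (Metric.sphere (0 : Fin n → ℝ) 1) := by
    refine ContinuousOn.div (Continuous.continuousOn (by fun_prop))
      (Continuous.continuousOn (by fun_prop)) fun v hv => ?_
    exact (dotProduct_self_pos (by rintro rfl; simp at hv)).ne'
  obtain ⟨α, hα, hmin⟩ : ∃ α > 0, ∀ v ∈ Metric.sphere (0 : Fin n → ℝ) 1,
      α * (v ⬝ᵥ v) ≤ v ⬝ᵥ M.mulVec v + k * (g ⬝ᵥ v) ^ 2 := by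
    rcases (Metric.sphere (0 : Fin n → ℝ) 1).eq_empty_or_nonempty with he | hne
    · exact ⟨1, one_pos, by simp [he]⟩
    · obtain ⟨u, hu, hmin⟩ := hK.exists_isMinOn hne hcont
      have hu0 : u ≠ 0 := by rintro rfl; simp at hu
      refine ⟨_, div_pos (hk hu) (dotProduct_self_pos hu0), ?_⟩
      intro v hv
      exact (le_div_iff₀ (dotProduct_self_pos (by rintro rfl; simp at hv))).1 (hmin hv)
  refine ⟨α, hα, fun v => ?_⟩
  rcases eq_or_ne v 0 with rfl | hv
  · simp
  have hn : ‖v‖ ≠ 0 := norm_ne_zero_iff.2 hv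
  have := hmin (‖v‖⁻¹ • v) (by simp [norm_smul, hn])
  rw [quadForm_smul] at this
  simp only [smul_dotProduct, dotProduct_smul, smul_eq_mul] at this
  have h2 : 0 < (‖v‖⁻¹) ^ 2 := by positivity
  refine le_of_mul_le_mul_left ?_ h2
  linarith

theorem strictMinIncrement_of_curvature_pos {A0 A1 : Matrix (Fin n) (Fin n) ℝ}
    {g0 g : Fin n → ℝ} {μ : ℝ} (hμ0 : 0 < μ) (hμ : g0 + μ • g = 0)
    (hpos : ∀ v : Fin n → ℝ, v ≠ 0 → g ⬝ᵥ v = 0 → 0 < v ⬝ᵥ (A0 + μ • A1).mulVec v) :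
    ∃ δ > 0, StrictMinIncrement A0 A1 g0 g 0 δ := by
  obtain ⟨σ, hσ, α, hα, hpen⟩ := exists_penalty _ g hpos
  obtain ⟨C, hC0, hC⟩ := exists_abs_quadForm_le A1
  have hG0 : 0 ≤ euclNorm g := Real.sqrt_nonneg _
  set G := euclNorm g
  refine ⟨min 1 (min (α / (σ * C ^ 2 + 1)) (μ / (σ * (2 * G + C) + 1))), by positivity, ?_⟩
  intro d hd hr hf
  have hr0 := euclNorm_pos hd
  have hgd : |g ⬝ᵥ d| ≤ G * euclNorm d := abs_dotProduct_le g d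
  have hQ := hC d
  have hp := hpen d
  have hg0 : g0 ⬝ᵥ d = -μ * (g ⬝ᵥ d) := by
    rw [eq_neg_of_add_eq_zero_left hμ, neg_dotProduct, smul_dotProduct, smul_eq_mul, neg_mul]
  rw [quadForm_add_smul_matrix] at hp
  rw [dotProduct_self_eq_euclNorm_sq] at hp hQ
  set r := euclNorm d
  set q := d ⬝ᵥ A1.mulVec d
  set y := g ⬝ᵥ d
  rw [lt_min_iff, lt_min_iff, lt_div_iff₀ (by positivity), lt_div_iff₀ (by positivity)] at hr
  obtain ⟨hr1, hr2, hr3⟩ := hr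
  rw [hg0]
  obtain ⟨s, hs⟩ : ∃ s, s = -(2 * y + q) := ⟨_, rfl⟩
  have hs0 : 0 ≤ s := by linarith
  have hrr : r ^ 2 ≤ r := by nlinarith
  have hsr : s ≤ (2 * G + C) * r := by
    nlinarith [neg_le_abs y, neg_le_abs q, mul_le_mul_of_nonneg_left hrr hC0]
  have hy : y ^ 2 ≤ (s ^ 2 + (C * r ^ 2) ^ 2) / 2 := by
    have hq2 : q ^ 2 ≤ (C * r ^ 2) ^ 2 := sq_le_sq' (by linarith [neg_le_abs q])
      ((le_abs_self q).trans hQ)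
    have : y = -(s + q) / 2 := by linarith
    rw [this]
    nlinarith [sq_nonneg (s - q)]
  have hσs : σ * s ^ 2 ≤ μ * s := by
    have : σ * s ≤ μ := by nlinarith [mul_le_mul_of_nonneg_left hsr hσ]
    nlinarith
  have hσC : σ * (C * r ^ 2) ^ 2 < α * r ^ 2 := by
    have h1 : σ * C ^ 2 * r ^ 2 < α := by
      nlinarith [mul_le_mul_of_nonneg_left hrr (mul_nonneg hσ (sq_nonneg C))]
    have h2 : 0 < r ^ 2 := by positivity
    nlinarith [mul_lt_mul_of_pos_right h1 h2]
  nlinarith [mul_le_mul_of_nonneg_left hy hσ, mul_nonneg hμ0.le hs0]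

theorem increment_nonneg_of_posSemidef {A0 A1 : Matrix (Fin n) (Fin n) ℝ} {g0 g : Fin n → ℝ}
    {μ : ℝ} (hμ0 : 0 ≤ μ) (hμ : g0 + μ • g = 0) {d : Fin n → ℝ}
    (hd : 0 ≤ d ⬝ᵥ (A0 + μ • A1).mulVec d) (hf : 2 * (g ⬝ᵥ d) + d ⬝ᵥ A1.mulVec d ≤ 0) :
    0 ≤ 2 * (g0 ⬝ᵥ d) + d ⬝ᵥ A0.mulVec d := by
  rw [eq_neg_of_add_eq_zero_left hμ, neg_dotProduct, smul_dotProduct, smul_eq_mul]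
  rw [quadForm_add_smul_matrix] at hd
  nlinarith

/-- If the Lagrangian has negative curvature along a direction transversal to the boundary, the
line in that direction contains a feasible point with a smaller objective value. -/
theorem exists_smul_increment_neg {A0 A1 : Matrix (Fin n) (Fin n) ℝ} {g0 g : Fin n → ℝ}
    {μ : ℝ} (hμ : g0 + μ • g = 0) {w : Fin n → ℝ}
    (hw : w ⬝ᵥ (A0 + μ • A1).mulVec w < 0) (hgw : g ⬝ᵥ w ≠ 0) :
    ∃ t : ℝ, 2 * (g ⬝ᵥ (t • w)) + (t • w) ⬝ᵥ A1.mulVec (t • w) ≤ 0 ∧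
      2 * (g0 ⬝ᵥ (t • w)) + (t • w) ⬝ᵥ A0.mulVec (t • w) < 0 := by
  have hg0 : g0 ⬝ᵥ w = -μ * (g ⬝ᵥ w) := by
    rw [eq_neg_of_add_eq_zero_left hμ, neg_dotProduct, smul_dotProduct, smul_eq_mul, neg_mul]
  simp only [quadForm_smul, dotProduct_smul, smul_eq_mul, hg0]
  rw [quadForm_add_smul_matrix] at hw
  set y := g ⬝ᵥ w
  set q := w ⬝ᵥ A1.mulVec w
  set p := w ⬝ᵥ A0.mulVec w
  by_cases hq : q = 0
  · rw [hq] at hw ⊢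
    have hp : p < 0 := by linarith
    -- along this line the constraint is affine and the objective is strictly concave
    obtain ⟨k, hk⟩ := exists_nat_gt (2 * |μ * y| / (-p))
    rw [div_lt_iff₀ (by linarith)] at hk
    have hk0 : (0 : ℝ) < k := by
      by_contra! h
      nlinarith [abs_nonneg (μ * y)]
    rcases lt_or_gt_of_ne hgw with hy | hy
    · refine ⟨k, by nlinarith, ?_⟩
      nlinarith [neg_le_abs (μ * y), mul_lt_mul_of_pos_left hk hk0]
    · refine ⟨-k, by nlinarith, ?_⟩
      nlinarith [le_abs_self (μ * y), mul_lt_mul_of_pos_left hk hk0]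
  · obtain ⟨t, ht⟩ : ∃ t, t * q = -(2 * y) := ⟨-(2 * y) / q, div_mul_cancel₀ _ hq⟩
    have ht0 : t ≠ 0 := by
      rintro rfl
      exact hgw (by linarith)
    refine ⟨t, le_of_eq (by linear_combination t * ht), ?_⟩
    have h2 : 0 < t ^ 2 := by positivity
    have e : 2 * (t * (-μ * y)) + t ^ 2 * p = t ^ 2 * (p + μ * q) := by
      linear_combination (-t * μ) * ht
    rw [e]
    exact mul_neg_of_pos_of_neg h2 hw

end QuadraticModel

theorem stmt9 {n : ℕ} (hn : 1 ≤ n)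
    (A0 A1 : Matrix (Fin n) (Fin n) ℝ) (hA0 : A0.IsSymm) (hA1 : A1.IsSymm)
    (b0 b1 : Fin n → ℝ) (c1 : ℝ) (xs : Fin n → ℝ) :
    IsStrictLNGMinGTR A0 A1 b0 b1 c1 xs ↔
      (qf1 A1 b1 c1 xs = 0 ∧
       ∃ μ : ℝ, 0 < μ ∧
          (A0.mulVec xs + b0) + μ • (A1.mulVec xs + b1) = 0 ∧
          (∀ v : Fin n → ℝ, v ≠ 0 → (A1.mulVec xs + b1) ⬝ᵥ v = 0 →
            0 < v ⬝ᵥ (A0 + μ • A1).mulVec v) ∧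
          ¬ (A0 + μ • A1).PosSemidef) := by
  constructor
  · rintro ⟨hloc, hglob⟩
    rw [isStrictLocalMinGTR_iff hA0 hA1] at hloc
    obtain ⟨hc, δ, hδ, h⟩ := hloc
    obtain ⟨d, hfd, hd⟩ : ∃ d, qf1 A1 b1 c1 xs + 2 * ((A1.mulVec xs + b1) ⬝ᵥ d)
        + d ⬝ᵥ A1.mulVec d ≤ 0 ∧ 2 * ((A0.mulVec xs + b0) ⬝ᵥ d) + d ⬝ᵥ A0.mulVec d < 0 := by
      by_contra! hno
      refine hglob ⟨hc, fun x hx => ?_⟩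
      have e : x = xs + (x - xs) := by abel
      rw [e, qf1_add hA1] at hx
      rw [e, qf0_add hA0]
      linarith [hno _ hx]
    have hc0 : qf1 A1 b1 c1 xs = 0 := by
      by_contra hne
      refine hd.not_ge (h.increment_nonneg_of_line hδ ?_)
      have hcont : Continuous fun t : ℝ => qf1 A1 b1 c1 xs
          + 2 * t * ((A1.mulVec xs + b1) ⬝ᵥ d) + t ^ 2 * (d ⬝ᵥ A1.mulVec d) := by fun_prop
      exact ((hcont.tendsto 0).eventually_lt_const
        (by simpa using lt_of_le_of_ne hc hne)).mono fun _ h => h.le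
    rw [hc0] at h hfd
    have hg : A1.mulVec xs + b1 ≠ 0 := by
      intro hg
      rw [hg, zero_dotProduct] at hfd
      refine hd.not_ge (h.increment_nonneg_of_line hδ (Eventually.of_forall fun t => ?_))
      rw [hg, zero_dotProduct]
      nlinarith [sq_nonneg t]
    obtain ⟨μ, hμ0, hμ⟩ := h.exists_multiplier hδ hg
    have hM := isSymm_add_smul hA0 hA1 μ
    have hd' : d ⬝ᵥ (A0 + μ • A1).mulVec d < 0 := by
      by_contra! hn
      exact hd.not_ge (increment_nonneg_of_posSemidef hμ0 hμ hn (by linarith))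
    exact ⟨hc0, μ, h.multiplier_pos hδ hμ0 hμ hg hd', hμ,
      fun v hv hgv => h.curvature_pos hδ hM hμ hg hd' hv hgv,
      fun hpsd => hd'.not_ge (hM.posSemidef_iff_quadForm_nonneg.1 hpsd d)⟩
  · rintro ⟨hc, μ, hμ0, hμ, hpos, hpsd⟩
    refine ⟨(isStrictLocalMinGTR_iff hA0 hA1 _ _ _ _).2 ⟨hc.le, ?_⟩, fun hglob => ?_⟩
    · rw [hc]
      exact strictMinIncrement_of_curvature_pos hμ0 hμ hpos
    · rw [(isSymm_add_smul hA0 hA1 μ).posSemidef_iff_quadForm_nonneg] at hpsd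
      push Not at hpsd
      obtain ⟨w, hw⟩ := hpsd
      have hgw : (A1.mulVec xs + b1) ⬝ᵥ w ≠ 0 := fun hgw =>
        hw.not_gt (hpos w (by rintro rfl; simp at hw) hgw)
      obtain ⟨t, h1, h2⟩ := exists_smul_increment_neg hμ hw hgw
      have := hglob.2 (xs + t • w) (by rw [qf1_add hA1, hc]; linarith)
      rw [qf0_add hA0] at this
      linarith
end

section
/- Suppose n ≥ 2. If y* is a local-nonglobal minimizer of problem (P+), then g(y*) = 0 and there exists a unique Lagrangian multiplier μ* ∈ ℝ, and it satisfies μ* ≠ 0 and (I + μ*A)y* + μ*b = 0. Moreover, if μ* > 0 then max{−λ₂, 0} < 1/μ* < −λ₁ and r₁ ≠ 0; and if μ* < 0 then max{λ_{n−1}, 0} < 1/|μ*| < λₙ and rₙ ≠ 0. -/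
open Matrix Finset

/-- The quadratic constraint `g(y) = yᵀAy + 2bᵀy + c`. -/
noncomputable def gq {n : ℕ} (A : Matrix (Fin n) (Fin n) ℝ) (b : Fin n → ℝ) (c : ℝ)
    (y : Fin n → ℝ) : ℝ := y ⬝ᵥ A.mulVec y + 2 * (b ⬝ᵥ y) + c

/-- Local-nonglobal minimizer of problem (P+): minimize `‖y‖²` subject to `g(y) = 0`. -/
def IsLNGMinPplus {n : ℕ} (A : Matrix (Fin n) (Fin n) ℝ) (b : Fin n → ℝ) (c : ℝ)
    (ys : Fin n → ℝ) : Prop :=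
  (gq A b c ys = 0 ∧ ∃ δ > (0:ℝ), ∀ y : Fin n → ℝ,
      gq A b c y = 0 → euclNorm (y - ys) < δ → ys ⬝ᵥ ys ≤ y ⬝ᵥ y) ∧
  ¬ (∀ y : Fin n → ℝ, gq A b c y = 0 → ys ⬝ᵥ ys ≤ y ⬝ᵥ y)

/-- Local-nonglobal minimizer of problem (P−): minimize `−‖y‖²` subject to `g(y) = 0`. -/
def IsLNGMinPminus {n : ℕ} (A : Matrix (Fin n) (Fin n) ℝ) (b : Fin n → ℝ) (c : ℝ)
    (ys : Fin n → ℝ) : Prop :=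
  (gq A b c ys = 0 ∧ ∃ δ > (0:ℝ), ∀ y : Fin n → ℝ,
      gq A b c y = 0 → euclNorm (y - ys) < δ → -(ys ⬝ᵥ ys) ≤ -(y ⬝ᵥ y)) ∧
  ¬ (∀ y : Fin n → ℝ, gq A b c y = 0 → -(ys ⬝ᵥ ys) ≤ -(y ⬝ᵥ y))

open Filter Topology in
/-- A perturbed linear equation `2 p σ + k + O(t) = 0` has bounded solutions `σ` for small `t`. -/
theorem exists_bounded_root {p : ℝ} (hp : p ≠ 0) (q a k : ℝ) :
    ∃ K : ℝ, ∀ᶠ t : ℝ in 𝓝 0, ∃ σ : ℝ, |σ| ≤ K ∧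
      2 * σ * p + 2 * t * σ * q + t ^ 2 * σ ^ 2 * a + k = 0 := by
  set F : ℝ → ℝ → ℝ := fun t σ => 2 * σ * p + 2 * t * σ * q + t ^ 2 * σ ^ 2 * a + k with hF
  set s : ℝ := -k / (2 * p) with hs
  have hsk : 2 * s * p + k = 0 := by rw [hs]; field_simp; ring
  refine ⟨|s| + 1, ?_⟩
  have hprod : F 0 (s - 1) * F 0 (s + 1) < 0 := by
    have h1 : F 0 (s - 1) = -(2 * p) := by simp only [hF]; linear_combination hsk
    have h2 : F 0 (s + 1) = 2 * p := by simp only [hF]; linear_combination hsk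
    rw [h1, h2]
    nlinarith [mul_self_pos.2 hp]
  have hcont : Continuous fun t => F t (s - 1) * F t (s + 1) := by simp only [hF]; fun_prop
  filter_upwards [hcont.continuousAt.eventually_lt continuousAt_const hprod] with t ht
  have hFt : ContinuousOn (F t) (Set.uIcc (s - 1) (s + 1)) := by
    apply Continuous.continuousOn; simp only [hF]; fun_prop
  have h0 : (0 : ℝ) ∈ Set.uIcc (F t (s - 1)) (F t (s + 1)) := by
    rcases mul_neg_iff.1 ht with ⟨h1, h2⟩ | ⟨h1, h2⟩
    · exact Set.mem_uIcc.2 (Or.inr ⟨h2.le, h1.le⟩)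
    · exact Set.mem_uIcc.2 (Or.inl ⟨h1.le, h2.le⟩)
  obtain ⟨σ, hσ, hroot⟩ := intermediate_value_uIcc hFt h0
  rw [Set.uIcc_of_le (by linarith)] at hσ
  refine ⟨σ, ?_, hroot⟩
  rw [abs_le]
  constructor <;> linarith [hσ.1, hσ.2, neg_abs_le s, le_abs_self s]

open Filter Topology in
/-- If `α + O(t)` is nonnegative for small `t > 0`, then `α` is nonnegative. -/
theorem nonneg_of_eventually_perturbed {α K : ℝ} {F : ℝ × ℝ → ℝ} (hF : Continuous F)
    (h : ∀ᶠ t : ℝ in 𝓝 0, 0 < t → ∃ σ : ℝ, |σ| ≤ K ∧ 0 ≤ α + t * F (t, σ)) : 0 ≤ α := by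
  obtain ⟨C, hC⟩ := ((isCompact_Icc (a := (0 : ℝ)) (b := 1)).prod
    (isCompact_Icc (a := -K) (b := K))).exists_bound_of_continuousOn hF.continuousOn
  have hlim : Tendsto (fun t : ℝ => α + t * C) (𝓝[>] 0) (𝓝 α) := by
    have : Continuous fun t : ℝ => α + t * C := by fun_prop
    simpa using (this.tendsto 0).mono_left nhdsWithin_le_nhds
  refine ge_of_tendsto hlim ?_
  filter_upwards [h.filter_mono nhdsWithin_le_nhds, self_mem_nhdsWithin,
    (eventually_le_nhds (zero_lt_one (α := ℝ))).filter_mono nhdsWithin_le_nhds] with t ht ht0 ht1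
  obtain ⟨σ, hσ, hnn⟩ := ht ht0
  have hb := hC (t, σ) ⟨⟨le_of_lt ht0, ht1⟩, abs_le.1 hσ⟩
  have := mul_le_mul_of_nonneg_left ((le_abs_self _).trans hb) (le_of_lt ht0)
  linarith

section QuadraticConstraint

variable {n : ℕ} {A : Matrix (Fin n) (Fin n) ℝ} {b : Fin n → ℝ} {c : ℝ} {ys : Fin n → ℝ}

theorem dotProduct_mulVec_comm_of_isSymm (hA : A.IsSymm) (x y : Fin n → ℝ) :
    x ⬝ᵥ A.mulVec y = y ⬝ᵥ A.mulVec x := by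
  rw [dotProduct_mulVec, ← mulVec_transpose, hA.eq, dotProduct_comm]

theorem gq_add (hA : A.IsSymm) (x : Fin n → ℝ) :
    gq A b c (ys + x) = gq A b c ys + 2 * ((A.mulVec ys + b) ⬝ᵥ x) + x ⬝ᵥ A.mulVec x := by
  simp only [gq, mulVec_add, dotProduct_add, add_dotProduct]
  rw [dotProduct_mulVec_comm_of_isSymm hA ys x, dotProduct_comm (A.mulVec ys) x]
  ring

theorem dotProduct_mulVec_add_smul (hA : A.IsSymm) (d e : Fin n → ℝ) (t s : ℝ) :
    (t • d + s • e) ⬝ᵥ A.mulVec (t • d + s • e) =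
      t ^ 2 * (d ⬝ᵥ A.mulVec d) + 2 * t * s * (d ⬝ᵥ A.mulVec e) + s ^ 2 * (e ⬝ᵥ A.mulVec e) := by
  simp only [mulVec_add, mulVec_smul, dotProduct_add, add_dotProduct, smul_dotProduct,
    dotProduct_smul, smul_eq_mul]
  rw [dotProduct_mulVec_comm_of_isSymm hA e d]
  ring

theorem dotProduct_add_smul_self (d e : Fin n → ℝ) (t s : ℝ) :
    (t • d + s • e) ⬝ᵥ (t • d + s • e) =
      t ^ 2 * (d ⬝ᵥ d) + 2 * t * s * (d ⬝ᵥ e) + s ^ 2 * (e ⬝ᵥ e) := by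
  simpa using dotProduct_mulVec_add_smul (A := 1) isSymm_one d e t s

open Filter Topology in
/-- Along a tangent direction `d`, a local minimizer is no longer than the nearby feasible points
`ys + t • d + (t ^ 2 * σ) • e` obtained by correcting along a transversal direction `e`. -/
theorem eventually_exists_feasible (hA : A.IsSymm) (hg : gq A b c ys = 0)
    (hloc : ∃ δ > (0 : ℝ), ∀ y : Fin n → ℝ,
      gq A b c y = 0 → euclNorm (y - ys) < δ → ys ⬝ᵥ ys ≤ y ⬝ᵥ y)
    {d e : Fin n → ℝ} (hd : (A.mulVec ys + b) ⬝ᵥ d = 0) (he : (A.mulVec ys + b) ⬝ᵥ e ≠ 0) :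
    ∃ K : ℝ, ∀ᶠ t : ℝ in 𝓝 0, ∃ σ : ℝ, |σ| ≤ K ∧
      2 * σ * ((A.mulVec ys + b) ⬝ᵥ e) + 2 * t * σ * (d ⬝ᵥ A.mulVec e)
        + t ^ 2 * σ ^ 2 * (e ⬝ᵥ A.mulVec e) + d ⬝ᵥ A.mulVec d = 0 ∧
      0 ≤ 2 * t * (ys ⬝ᵥ d) + 2 * (t ^ 2 * σ) * (ys ⬝ᵥ e) +
        (t ^ 2 * (d ⬝ᵥ d) + 2 * t * (t ^ 2 * σ) * (d ⬝ᵥ e) + (t ^ 2 * σ) ^ 2 * (e ⬝ᵥ e)) := by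
  obtain ⟨δ, hδ, hmin⟩ := hloc
  obtain ⟨K, hroot⟩ := exists_bounded_root he (d ⬝ᵥ A.mulVec e) (e ⬝ᵥ A.mulVec e)
    (d ⬝ᵥ A.mulVec d)
  refine ⟨K, ?_⟩
  have hcont : Continuous fun t : ℝ =>
      t ^ 2 * (d ⬝ᵥ d) + 2 * |t| * (t ^ 2 * K) * |d ⬝ᵥ e| + (t ^ 2 * K) ^ 2 * (e ⬝ᵥ e) := by
    fun_prop
  have hsmall := hcont.continuousAt.eventually_lt (x₀ := 0)
    (continuousAt_const (y := δ ^ 2)) (by simpa using pow_pos hδ 2)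
  filter_upwards [hroot, hsmall] with t ⟨σ, hσ, hσ0⟩ ht
  refine ⟨σ, hσ, hσ0, ?_⟩
  have hfeas : gq A b c (ys + (t • d + (t ^ 2 * σ) • e)) = 0 := by
    rw [gq_add hA, dotProduct_mulVec_add_smul hA, hg, dotProduct_add, dotProduct_smul,
      dotProduct_smul, hd, smul_eq_mul, smul_eq_mul]
    linear_combination t ^ 2 * hσ0
  have hnear : euclNorm (ys + (t • d + (t ^ 2 * σ) • e) - ys) < δ := by
    rw [add_sub_cancel_left, euclNorm, Real.sqrt_lt' hδ, dotProduct_add_smul_self]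
    refine lt_of_le_of_lt ?_ ht
    have h1 : 2 * t * (t ^ 2 * σ) * (d ⬝ᵥ e) ≤ 2 * |t| * (t ^ 2 * K) * |d ⬝ᵥ e| := by
      refine (le_abs_self _).trans ?_
      rw [abs_mul, abs_mul, abs_mul, abs_mul, abs_two, abs_of_nonneg (sq_nonneg t)]
      gcongr
    have h2 : (t ^ 2 * σ) ^ 2 * (e ⬝ᵥ e) ≤ (t ^ 2 * K) ^ 2 * (e ⬝ᵥ e) := by
      have hee : 0 ≤ e ⬝ᵥ e := by simpa using dotProduct_star_self_nonneg e
      have : σ ^ 2 ≤ K ^ 2 := sq_le_sq' (abs_le.1 hσ).1 (abs_le.1 hσ).2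
      rw [mul_pow, mul_pow]
      gcongr
    linarith
  have h := hmin _ hfeas hnear
  rw [add_dotProduct, dotProduct_add ys, dotProduct_add (_ + _) ys, dotProduct_add_smul_self,
    dotProduct_comm (_ + _) ys, dotProduct_add, dotProduct_smul, dotProduct_smul, smul_eq_mul,
    smul_eq_mul] at h
  linarith

/-- First-order condition: a local minimizer is orthogonal to the tangent directions. -/
theorem dotProduct_eq_zero_of_tangent (hA : A.IsSymm) (hg : gq A b c ys = 0)
    (hloc : ∃ δ > (0 : ℝ), ∀ y : Fin n → ℝ,
      gq A b c y = 0 → euclNorm (y - ys) < δ → ys ⬝ᵥ ys ≤ y ⬝ᵥ y)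
    (hw : A.mulVec ys + b ≠ 0) {d : Fin n → ℝ} (hd : (A.mulVec ys + b) ⬝ᵥ d = 0) :
    ys ⬝ᵥ d = 0 := by
  have key : ∀ d : Fin n → ℝ, (A.mulVec ys + b) ⬝ᵥ d = 0 → 0 ≤ 2 * (ys ⬝ᵥ d) := by
    intro d hd
    set e := A.mulVec ys + b with he
    obtain ⟨K, h⟩ := eventually_exists_feasible hA hg hloc (e := e) hd
      (fun h => hw (dotProduct_self_eq_zero.1 h))
    refine nonneg_of_eventually_perturbed (K := K)
      (F := fun x => 2 * x.2 * (ys ⬝ᵥ e) + (d ⬝ᵥ d) + 2 * x.1 * x.2 * (d ⬝ᵥ e)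
        + x.1 ^ 2 * x.2 ^ 2 * (e ⬝ᵥ e)) (by fun_prop) ?_
    filter_upwards [h] with t hroot ht
    obtain ⟨σ, hσ, -, hnn⟩ := hroot
    refine ⟨σ, hσ, nonneg_of_mul_nonneg_right (hnn.trans_eq ?_) ht⟩
    ring
  have h1 := key d hd
  have h2 := key (-d) (by rw [dotProduct_neg, hd, neg_zero])
  rw [dotProduct_neg] at h2
  linarith

theorem exists_multiplier (hA : A.IsSymm) (hg : gq A b c ys = 0)
    (hloc : ∃ δ > (0 : ℝ), ∀ y : Fin n → ℝ,
      gq A b c y = 0 → euclNorm (y - ys) < δ → ys ⬝ᵥ ys ≤ y ⬝ᵥ y)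
    (hw : A.mulVec ys + b ≠ 0) : ∃ μ : ℝ, ys + μ • (A.mulVec ys + b) = 0 := by
  set w := A.mulVec ys + b with hwdef
  have hww : w ⬝ᵥ w ≠ 0 := fun h => hw (dotProduct_self_eq_zero.1 h)
  refine ⟨-((w ⬝ᵥ ys) / (w ⬝ᵥ w)), ?_⟩
  set d := ys + (-((w ⬝ᵥ ys) / (w ⬝ᵥ w))) • w with hddef
  have hwd : w ⬝ᵥ d = 0 := by
    rw [hddef, dotProduct_add, dotProduct_smul, smul_eq_mul]
    field_simp
    ring
  have hyd : ys ⬝ᵥ d = 0 := dotProduct_eq_zero_of_tangent hA hg hloc hw hwd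
  refine dotProduct_self_eq_zero.1 ?_
  nth_rw 1 [hddef]
  rw [add_dotProduct, smul_dotProduct, hwd, hyd, smul_zero, add_zero]

/-- At a singular point of the constraint, a local minimizer is global. -/
theorem le_of_gradient_eq_zero (hA : A.IsSymm) (hg : gq A b c ys = 0)
    (hloc : ∃ δ > (0 : ℝ), ∀ y : Fin n → ℝ,
      gq A b c y = 0 → euclNorm (y - ys) < δ → ys ⬝ᵥ ys ≤ y ⬝ᵥ y)
    (hw : A.mulVec ys + b = 0) (y : Fin n → ℝ) (hy : gq A b c y = 0) :
    ys ⬝ᵥ ys ≤ y ⬝ᵥ y := by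
  obtain ⟨δ, hδ, hmin⟩ := hloc
  obtain ⟨x, rfl⟩ : ∃ x, y = ys + x := ⟨y - ys, by abel⟩
  have hxA : x ⬝ᵥ A.mulVec x = 0 := by simpa [gq_add hA, hg, hw] using hy
  have hxx : 0 ≤ x ⬝ᵥ x := by simpa using dotProduct_star_self_nonneg x
  have hexpand : ∀ t : ℝ, (ys + t • x) ⬝ᵥ (ys + t • x) =
      ys ⬝ᵥ ys + t * (2 * (ys ⬝ᵥ x) + t * (x ⬝ᵥ x)) := by
    intro t
    have := dotProduct_add_smul_self ys x 1 t
    rw [one_smul] at this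
    rw [this]
    ring
  have hcont : Continuous fun t : ℝ => t ^ 2 * (x ⬝ᵥ x) := by fun_prop
  have hsmall := hcont.continuousAt.eventually_lt (x₀ := 0)
    (continuousAt_const (y := δ ^ 2)) (by simpa using pow_pos hδ 2)
  have hys : 0 ≤ 2 * (ys ⬝ᵥ x) := by
    refine nonneg_of_eventually_perturbed (K := 0) (F := fun _ => x ⬝ᵥ x) continuous_const ?_
    filter_upwards [hsmall] with t ht ht0
    refine ⟨0, by simp, nonneg_of_mul_nonneg_right (a := t) ?_ ht0⟩
    have hfeas : gq A b c (ys + t • x) = 0 := by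
      simp [gq_add hA, hg, hw, mulVec_smul, hxA]
    have hnear : euclNorm (ys + t • x - ys) < δ := by
      rw [add_sub_cancel_left, euclNorm, Real.sqrt_lt' hδ, smul_dotProduct, dotProduct_smul,
        smul_eq_mul, smul_eq_mul]
      linarith
    have := hmin _ hfeas hnear
    rw [hexpand] at this
    linarith
  have := hexpand 1
  rw [one_smul] at this
  rw [this]
  linarith

theorem dotProduct_eq_of_multiplier {μ : ℝ} (hμ : ys + μ • (A.mulVec ys + b) = 0)
    (x : Fin n → ℝ) : ys ⬝ᵥ x = -μ * ((A.mulVec ys + b) ⬝ᵥ x) := by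
  have := congrArg (· ⬝ᵥ x) hμ
  simp only [add_dotProduct ys, smul_dotProduct, zero_dotProduct, smul_eq_mul] at this
  linarith

/-- On the feasible set the objective gap is the quadratic form of the Lagrangian. -/
theorem dotProduct_self_sub_of_feasible (hA : A.IsSymm) (hg : gq A b c ys = 0) {μ : ℝ}
    (hμ : ys + μ • (A.mulVec ys + b) = 0) {x : Fin n → ℝ} (hx : gq A b c (ys + x) = 0) :
    (ys + x) ⬝ᵥ (ys + x) - ys ⬝ᵥ ys = x ⬝ᵥ x + μ * (x ⬝ᵥ A.mulVec x) := by
  have h1 := dotProduct_eq_of_multiplier hμ x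
  rw [gq_add hA, hg] at hx
  rw [add_dotProduct, dotProduct_add, dotProduct_add, dotProduct_comm x ys]
  linear_combination 2 * h1 - μ * hx

/-- Second-order necessary condition. -/
theorem lagrangian_nonneg_of_tangent (hA : A.IsSymm) (hg : gq A b c ys = 0)
    (hloc : ∃ δ > (0 : ℝ), ∀ y : Fin n → ℝ,
      gq A b c y = 0 → euclNorm (y - ys) < δ → ys ⬝ᵥ ys ≤ y ⬝ᵥ y)
    (hw : A.mulVec ys + b ≠ 0) {μ : ℝ} (hμ : ys + μ • (A.mulVec ys + b) = 0)
    {d : Fin n → ℝ} (hd : (A.mulVec ys + b) ⬝ᵥ d = 0) :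
    0 ≤ d ⬝ᵥ d + μ * (d ⬝ᵥ A.mulVec d) := by
  have hyd := dotProduct_eq_of_multiplier hμ d
  have hye := dotProduct_eq_of_multiplier hμ (A.mulVec ys + b)
  set e := A.mulVec ys + b with he
  obtain ⟨K, h⟩ := eventually_exists_feasible hA hg hloc (e := e) hd
    (fun h => hw (dotProduct_self_eq_zero.1 h))
  refine nonneg_of_eventually_perturbed (K := K)
    (F := fun x => 2 * x.2 * (d ⬝ᵥ e + μ * (d ⬝ᵥ A.mulVec e))
      + x.1 * x.2 ^ 2 * (e ⬝ᵥ e + μ * (e ⬝ᵥ A.mulVec e))) (by fun_prop) ?_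
  filter_upwards [h] with t hroot ht
  obtain ⟨σ, hσ, hσ0, hnn⟩ := hroot
  refine ⟨σ, hσ, nonneg_of_mul_nonneg_right (a := t ^ 2) (hnn.trans_eq ?_) (by positivity)⟩
  rw [hyd, hye, hd]
  linear_combination -μ * t ^ 2 * hσ0

open Filter Topology in
/-- A nonzero tangent direction in which the Lagrangian degenerates cannot be conjugate to a
transversal direction of negative curvature. -/
theorem eq_zero_of_degenerate (hA : A.IsSymm) (hg : gq A b c ys = 0)
    (hloc : ∃ δ > (0 : ℝ), ∀ y : Fin n → ℝ,
      gq A b c y = 0 → euclNorm (y - ys) < δ → ys ⬝ᵥ ys ≤ y ⬝ᵥ y)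
    {μ : ℝ} (hμ : ys + μ • (A.mulVec ys + b) = 0) {d e : Fin n → ℝ}
    (hd : (A.mulVec ys + b) ⬝ᵥ d = 0) (he : (A.mulVec ys + b) ⬝ᵥ e ≠ 0)
    (hdd : d ⬝ᵥ d + μ * (d ⬝ᵥ A.mulVec d) = 0) (hde : d ⬝ᵥ e + μ * (d ⬝ᵥ A.mulVec e) = 0)
    (hee : e ⬝ᵥ e + μ * (e ⬝ᵥ A.mulVec e) < 0) : d = 0 := by
  obtain ⟨K, h⟩ := eventually_exists_feasible hA hg hloc hd he
  obtain ⟨t, ⟨σ, -, hσ0, hnn⟩, ht⟩ :=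
    ((h.filter_mono nhdsWithin_le_nhds).and (self_mem_nhdsWithin (s := Set.Ioi (0 : ℝ)))).exists
  replace ht : 0 < t := ht
  rw [dotProduct_eq_of_multiplier hμ d, dotProduct_eq_of_multiplier hμ e, hd] at hnn
  have hgap : 0 ≤ t ^ 4 * σ ^ 2 * (e ⬝ᵥ e + μ * (e ⬝ᵥ A.mulVec e)) := by
    refine hnn.trans_eq ?_
    linear_combination t ^ 2 * hdd + 2 * t ^ 3 * σ * hde - μ * t ^ 2 * hσ0
  have hσ : σ = 0 := by
    by_contra hne
    have : 0 < t ^ 4 * σ ^ 2 := by positivity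
    nlinarith
  subst hσ
  have hAd : d ⬝ᵥ A.mulVec d = 0 := by simpa using hσ0
  exact dotProduct_self_eq_zero.1 (by simpa [hAd] using hdd)

theorem eigenvalue_pos_of_ne_of_neg (hA : A.IsSymm) (hg : gq A b c ys = 0)
    (hloc : ∃ δ > (0 : ℝ), ∀ y : Fin n → ℝ,
      gq A b c y = 0 → euclNorm (y - ys) < δ → ys ⬝ᵥ ys ≤ y ⬝ᵥ y)
    (hw : A.mulVec ys + b ≠ 0) {μ : ℝ} (hμ : ys + μ • (A.mulVec ys + b) = 0)
    {lam : Fin n → ℝ} {v : Fin n → Fin n → ℝ}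
    (horth : ∀ i j : Fin n, v i ⬝ᵥ v j = if i = j then (1:ℝ) else 0)
    (heig : ∀ i : Fin n, A.mulVec (v i) = lam i • v i) {i : Fin n} (hi : 1 + μ * lam i < 0) :
    v i ⬝ᵥ b ≠ 0 ∧ ∀ j, j ≠ i → 0 < 1 + μ * lam j := by
  have hwi : (A.mulVec ys + b) ⬝ᵥ v i ≠ 0 := by
    intro h0
    have := lagrangian_nonneg_of_tangent hA hg hloc hw hμ h0
    simp [heig, horth] at this
    linarith
  refine ⟨fun h0 => ?_, fun j hj => ?_⟩
  · have hAv : A.mulVec ys ⬝ᵥ v i = lam i * (ys ⬝ᵥ v i) := by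
      rw [dotProduct_comm, dotProduct_mulVec_comm_of_isSymm hA, heig, dotProduct_smul, smul_eq_mul]
    have hsum : (A.mulVec ys + b) ⬝ᵥ v i = lam i * (ys ⬝ᵥ v i) := by
      rw [add_dotProduct, hAv, dotProduct_comm b, h0, add_zero]
    rw [dotProduct_eq_of_multiplier hμ] at hsum
    have : (1 + μ * lam i) * ((A.mulVec ys + b) ⬝ᵥ v i) = 0 := by linear_combination hsum
    exact (mul_ne_zero hi.ne hwi) this
  · by_contra hle
    rw [not_lt] at hle
    set p := (A.mulVec ys + b) ⬝ᵥ v i with hp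
    set q := (A.mulVec ys + b) ⬝ᵥ v j with hq
    have htan : (A.mulVec ys + b) ⬝ᵥ (p • v j + (-q) • v i) = 0 := by
      rw [dotProduct_add, dotProduct_smul, dotProduct_smul, ← hp, ← hq, smul_eq_mul, smul_eq_mul]
      ring
    have hnn := lagrangian_nonneg_of_tangent hA hg hloc hw hμ htan
    rw [dotProduct_add_smul_self, dotProduct_mulVec_add_smul hA] at hnn
    simp only [heig, horth, dotProduct_smul, if_neg hj, if_true, smul_eq_mul] at hnn
    have hp2 : 0 < p ^ 2 := by positivity
    have hq0 : q = 0 := by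
      by_contra hne
      have : 0 < q ^ 2 := by positivity
      nlinarith
    have hj0 : 1 + μ * lam j = 0 := by
      rw [hq0] at hnn
      nlinarith
    have hvj : v j = 0 := by
      refine eq_zero_of_degenerate hA hg hloc hμ (d := v j) (e := v i) hq0 hwi ?_ ?_ ?_
      · simpa [heig, horth] using hj0
      · simp [heig, horth, hj]
      · simpa [heig, horth] using hi
    simpa [hvj] using horth j j

theorem dotProduct_eq_sum_of_orthonormal {v : Fin n → Fin n → ℝ}
    (horth : ∀ i j : Fin n, v i ⬝ᵥ v j = if i = j then (1:ℝ) else 0) (x y : Fin n → ℝ) :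
    x ⬝ᵥ y = ∑ i, (v i ⬝ᵥ x) * (v i ⬝ᵥ y) := by
  have hV : Matrix.of v * (Matrix.of v)ᵀ = 1 := by
    ext i j
    rw [Matrix.one_apply]
    exact horth i j
  calc x ⬝ᵥ y = x ⬝ᵥ ((Matrix.of v)ᵀ * Matrix.of v).mulVec y := by
        rw [mul_eq_one_comm.1 hV, one_mulVec]
    _ = (Matrix.of v).mulVec x ⬝ᵥ (Matrix.of v).mulVec y := by
        rw [← mulVec_mulVec, dotProduct_mulVec, vecMul_transpose]
    _ = _ := rfl

/-- A local-nonglobal minimizer has a negative eigenvalue of the Lagrangian. -/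
theorem exists_eigenvalue_neg (hA : A.IsSymm) (hg : gq A b c ys = 0)
    (hglob : ¬ ∀ y : Fin n → ℝ, gq A b c y = 0 → ys ⬝ᵥ ys ≤ y ⬝ᵥ y)
    {μ : ℝ} (hμ : ys + μ • (A.mulVec ys + b) = 0)
    {lam : Fin n → ℝ} {v : Fin n → Fin n → ℝ}
    (horth : ∀ i j : Fin n, v i ⬝ᵥ v j = if i = j then (1:ℝ) else 0)
    (heig : ∀ i : Fin n, A.mulVec (v i) = lam i • v i) :
    ∃ i, 1 + μ * lam i < 0 := by
  by_contra! hnn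
  refine hglob fun y hy => ?_
  obtain ⟨x, rfl⟩ : ∃ x, y = ys + x := ⟨y - ys, by abel⟩
  rw [← sub_nonneg, dotProduct_self_sub_of_feasible hA hg hμ hy,
    dotProduct_eq_sum_of_orthonormal horth x x, dotProduct_eq_sum_of_orthonormal horth x,
    Finset.mul_sum, ← Finset.sum_add_distrib]
  refine Finset.sum_nonneg fun i _ => ?_
  rw [dotProduct_mulVec_comm_of_isSymm hA, heig, dotProduct_smul, smul_eq_mul,
    dotProduct_comm x]
  calc 0 ≤ (1 + μ * lam i) * (v i ⬝ᵥ x) ^ 2 := mul_nonneg (hnn i) (sq_nonneg _)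
    _ = _ := by ring

end QuadraticConstraint

theorem stmt12 {n : ℕ} (hn : 2 ≤ n)
    (A : Matrix (Fin n) (Fin n) ℝ) (hA : A.IsSymm)
    (b : Fin n → ℝ) (c : ℝ)
    (lam : Fin n → ℝ) (hmono : Monotone lam)
    (v : Fin n → Fin n → ℝ)
    (horth : ∀ i j : Fin n, v i ⬝ᵥ v j = if i = j then (1:ℝ) else 0)
    (heig : ∀ i : Fin n, A.mulVec (v i) = lam i • v i)
    (ys : Fin n → ℝ)
    (hys : IsLNGMinPplus A b c ys) :
    gq A b c ys = 0 ∧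
    ∃ μ : ℝ,
      ((1 : Matrix (Fin n) (Fin n) ℝ) + μ • A).mulVec ys + μ • b = 0 ∧
      (∀ μ' : ℝ, ((1 : Matrix (Fin n) (Fin n) ℝ) + μ' • A).mulVec ys + μ' • b = 0 → μ' = μ) ∧
      μ ≠ 0 ∧
      (0 < μ →
        max (-(lam ⟨1, by omega⟩)) 0 < 1 / μ ∧ 1 / μ < -(lam ⟨0, by omega⟩) ∧
        v ⟨0, by omega⟩ ⬝ᵥ b ≠ 0) ∧
      (μ < 0 →
        max (lam ⟨n - 2, by omega⟩) 0 < 1 / |μ| ∧ 1 / |μ| < lam ⟨n - 1, by omega⟩ ∧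
        v ⟨n - 1, by omega⟩ ⬝ᵥ b ≠ 0) := by
  obtain ⟨⟨hg, hloc⟩, hglob⟩ := hys
  have hw : A.mulVec ys + b ≠ 0 := fun h => hglob (le_of_gradient_eq_zero hA hg hloc h)
  obtain ⟨μ, hμ⟩ := exists_multiplier hA hg hloc hw
  have hform : ∀ m : ℝ, ((1 : Matrix (Fin n) (Fin n) ℝ) + m • A).mulVec ys + m • b =
      ys + m • (A.mulVec ys + b) := by
    intro m
    rw [add_mulVec, one_mulVec, smul_mulVec, smul_add, add_assoc]
  obtain ⟨k, hk⟩ := exists_eigenvalue_neg hA hg hglob hμ horth heig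
  have hsep : ∀ {i : Fin n}, 1 + μ * lam i < 0 → v i ⬝ᵥ b ≠ 0 ∧ ∀ j, j ≠ i → 0 < 1 + μ * lam j :=
    eigenvalue_pos_of_ne_of_neg hA hg hloc hw hμ horth heig
  refine ⟨hg, μ, (hform μ).trans hμ, fun μ' hμ' => ?_, ?_, fun hpos => ?_, fun hneg => ?_⟩
  · rw [hform, ← hμ, add_right_inj] at hμ'
    exact smul_left_injective ℝ hw hμ'
  · rintro rfl
    norm_num at hk
  · have hmin : lam ⟨0, by omega⟩ ≤ lam k := hmono (Nat.zero_le _)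
    have h0 : 1 + μ * lam ⟨0, by omega⟩ < 0 := by nlinarith
    obtain ⟨hr, hrest⟩ := hsep h0
    have h1 := hrest ⟨1, by omega⟩ (by simp)
    refine ⟨max_lt ?_ (by positivity), ?_, hr⟩
    · rw [lt_div_iff₀ hpos]
      linarith
    · rw [div_lt_iff₀ hpos]
      linarith
  · have hmax : lam k ≤ lam ⟨n - 1, by omega⟩ := hmono (Nat.le_sub_one_of_lt k.2)
    have h0 : 1 + μ * lam ⟨n - 1, by omega⟩ < 0 := by nlinarith
    obtain ⟨hr, hrest⟩ := hsep h0
    have h1 := hrest ⟨n - 2, by omega⟩ (by simp only [ne_eq, Fin.mk.injEq]; omega)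
    have habs : 0 < |μ| := abs_pos.2 hneg.ne
    refine ⟨max_lt ?_ (by positivity), ?_, hr⟩
    · rw [lt_div_iff₀ habs, abs_of_neg hneg]
      linarith
    · rw [div_lt_iff₀ habs, abs_of_neg hneg]
      linarith
end

section
/- Suppose n ≥ 2. For y* ∈ ℝⁿ and η* > 0, the point y* is a local-nonglobal minimizer of problem (P+) satisfying the stationarity condition (I + (1/η*)A)y* + (1/η*)b = 0 if and only if max{−λ₂, 0} < η* < −λ₁, r₁ ≠ 0, y* = y₁(η*), ψ₁(η*) = 0 and ψ₁′(η*) < 0. -/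
open Matrix Finset

/-- `y₁(η) = −∑ᵢ (rᵢ/(λᵢ+η)) vᵢ`. -/
noncomputable def yOne {n : ℕ} (lam : Fin n → ℝ) (v : Fin n → Fin n → ℝ) (b : Fin n → ℝ)
    (η : ℝ) : Fin n → ℝ :=
  -∑ i : Fin n, ((v i ⬝ᵥ b) / (lam i + η)) • v i

/-- `ψ₁(η) = ∑ᵢ λᵢrᵢ²/(λᵢ+η)² − ∑ᵢ 2rᵢ²/(λᵢ+η) + c`. -/
noncomputable def psiOne {n : ℕ} (lam : Fin n → ℝ) (v : Fin n → Fin n → ℝ) (b : Fin n → ℝ)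
    (c : ℝ) (η : ℝ) : ℝ :=
  (∑ i : Fin n, lam i * (v i ⬝ᵥ b) ^ 2 / (lam i + η) ^ 2) -
    (∑ i : Fin n, 2 * (v i ⬝ᵥ b) ^ 2 / (lam i + η)) + c

/-- `ψ₁′(η) = 2η ∑ᵢ rᵢ²/(λᵢ+η)³`. -/
noncomputable def psiOne' {n : ℕ} (lam : Fin n → ℝ) (v : Fin n → Fin n → ℝ) (b : Fin n → ℝ)
    (η : ℝ) : ℝ :=
  2 * η * ∑ i : Fin n, (v i ⬝ᵥ b) ^ 2 / (lam i + η) ^ 3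

section DiagonalForms

variable {ι : Type*} [Fintype ι]

lemma sum_mul_linComb_sq (k u w : ι → ℝ) (t s : ℝ) :
    ∑ i, k i * (t * u i + s * w i) ^ 2 =
      t ^ 2 * ∑ i, k i * u i ^ 2 + 2 * t * s * ∑ i, k i * u i * w i
        + s ^ 2 * ∑ i, k i * w i ^ 2 := by
  simp only [mul_sum, ← sum_add_distrib]
  exact sum_congr rfl fun i _ => by ring

lemma sum_mul_linComb (p u w : ι → ℝ) (t s : ℝ) :
    ∑ i, p i * (t * u i + s * w i) = t * ∑ i, p i * u i + s * ∑ i, p i * w i := by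
  simp only [mul_sum, ← sum_add_distrib]
  exact sum_congr rfl fun i _ => by ring

lemma sum_add_const_mul_sq (l d : ι → ℝ) (η : ℝ) :
    ∑ i, (l i + η) * d i ^ 2 = ∑ i, l i * d i ^ 2 + η * ∑ i, d i ^ 2 := by
  simp only [mul_sum, ← sum_add_distrib]
  exact sum_congr rfl fun i _ => by ring

/-- A perturbed linear equation with a negative solution keeps a bounded nonpositive solution. -/
lemma eventually_exists_nonpos_root {a β γ η : ℝ} (hη : 0 < η) (hγ : γ < 0) :
    ∀ᶠ t in nhds (0 : ℝ), ∃ σ ∈ Set.Icc (γ / η) 0,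
      a * t ^ 2 * σ ^ 2 + 2 * (t * β - η) * σ + γ = 0 := by
  have hc : Continuous fun t : ℝ => a * t ^ 2 * (γ / η) ^ 2 + 2 * (t * β - η) * (γ / η) + γ := by
    fun_prop
  have h0 : 0 < a * (0 : ℝ) ^ 2 * (γ / η) ^ 2 + 2 * (0 * β - η) * (γ / η) + γ := by
    have : η * (γ / η) = γ := by field_simp
    nlinarith
  filter_upwards [hc.continuousAt.eventually (lt_mem_nhds h0)] with t ht
  have hle : γ / η ≤ 0 := (div_neg_of_neg_of_pos hγ hη).le
  have hcs : ContinuousOn (fun σ : ℝ => a * t ^ 2 * σ ^ 2 + 2 * (t * β - η) * σ + γ)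
      (Set.Icc (γ / η) 0) := by fun_prop
  obtain ⟨σ, hσ, he⟩ := intermediate_value_Icc' hle hcs
    (show (0 : ℝ) ∈ Set.Icc _ _ from ⟨by simpa using hγ.le, ht.le⟩)
  exact ⟨σ, hσ, he⟩

/-- At a local minimizer, if the Hessian of the Lagrangian is negative in some direction
transversal to the constraint surface, then it is positive definite on the tangent space. -/
lemma tangent_pos_of_local {l p w u : ι → ℝ} {η δ : ℝ} (hη : 0 < η) (hδ : 0 < δ)
    (hloc : ∀ d : ι → ℝ, ∑ i, l i * d i ^ 2 = 2 * η * ∑ i, p i * d i →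
      √(∑ i, d i ^ 2) < δ → 0 ≤ ∑ i, (l i + η) * d i ^ 2)
    (hw : ∑ i, p i * w i ≠ 0) (hW : ∑ i, (l i + η) * w i ^ 2 < 0)
    (hu : u ≠ 0) (hpu : ∑ i, p i * u i = 0) :
    0 < ∑ i, (l i + η) * u i ^ 2 := by
  by_contra! hU
  set κ := ∑ i, p i * w i with hκ
  have hu2 : 0 < ∑ i, u i ^ 2 := by
    obtain ⟨j, hj⟩ := Function.ne_iff.1 hu
    exact sum_pos' (fun i _ => sq_nonneg _) ⟨j, mem_univ j, by
      have : u j ≠ 0 := hj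
      positivity⟩
  have hγ : ∑ i, l i * u i ^ 2 < 0 := by
    have := sum_add_const_mul_sq l u η
    nlinarith
  set γ := ∑ i, l i * u i ^ 2 with hγd
  set a := (∑ i, l i * w i ^ 2) / κ ^ 2 with ha
  set β := (∑ i, l i * u i * w i) / κ with hβ
  set M := γ / η with hM
  have hsmall : ∀ᶠ t in nhds (0 : ℝ),
      2 * t ^ 2 * ∑ i, u i ^ 2 + 2 * (t ^ 2 * M / κ) ^ 2 * ∑ i, w i ^ 2 < δ ^ 2 := by
    have hc : Continuous fun t : ℝ =>
        2 * t ^ 2 * ∑ i, u i ^ 2 + 2 * (t ^ 2 * M / κ) ^ 2 * ∑ i, w i ^ 2 := by fun_prop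
    refine hc.continuousAt.eventually (gt_mem_nhds ?_)
    simpa using pow_pos hδ 2
  obtain ⟨ε, hε, hball⟩ := Metric.eventually_nhds_iff.1
    ((eventually_exists_nonpos_root (a := a) (β := β) hη hγ).and hsmall)
  obtain ⟨t, ht0, htε, htV⟩ : ∃ t : ℝ, t ≠ 0 ∧ |t| < ε ∧
      0 ≤ t * ((∑ i, (l i + η) * u i * w i) / κ) := by
    rcases le_total 0 ((∑ i, (l i + η) * u i * w i) / κ) with h | h
    · exact ⟨ε / 2, by positivity, by rw [abs_of_pos] <;> linarith, by positivity⟩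
    · exact ⟨-(ε / 2), by simpa using hε.ne', by rw [abs_neg, abs_of_pos] <;> linarith,
        mul_nonneg_of_nonpos_of_nonpos (by linarith) h⟩
  obtain ⟨⟨σ, ⟨hσM, hσ0⟩, hσ⟩, hts⟩ := hball (y := t) (by simpa using htε)
  have hσne : σ ≠ 0 := by
    rintro rfl
    simp at hσ
    exact hγ.ne hσ
  have key := hloc (fun i => t * u i + (t ^ 2 * σ / κ) * w i) ?_ ?_
  · rw [sum_mul_linComb_sq] at key
    have e : 2 * t * (t ^ 2 * σ / κ) * ∑ i, (l i + η) * u i * w i =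
        2 * t ^ 2 * (σ * (t * ((∑ i, (l i + η) * u i * w i) / κ))) := by
      field_simp
    have h1 : σ * (t * ((∑ i, (l i + η) * u i * w i) / κ)) ≤ 0 :=
      mul_nonpos_of_nonpos_of_nonneg hσ0 htV
    have h2 : 0 < (t ^ 2 * σ / κ) ^ 2 := by positivity
    have h3 : 0 < t ^ 2 := by positivity
    rw [e] at key
    nlinarith [mul_neg_of_pos_of_neg h2 hW, mul_nonneg h3.le (neg_nonneg.2 h1),
      mul_nonneg h3.le (neg_nonneg.2 hU)]
  · rw [sum_mul_linComb_sq, sum_mul_linComb, hpu, ← hκ, ← hγd]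
    have e1 : ∑ i, l i * u i * w i = β * κ := by rw [hβ]; field_simp
    have e2 : ∑ i, l i * w i ^ 2 = a * κ ^ 2 := by rw [ha]; field_simp
    rw [e1, e2]
    have : t ^ 2 * γ + 2 * t * (t ^ 2 * σ / κ) * (β * κ) + (t ^ 2 * σ / κ) ^ 2 * (a * κ ^ 2) -
        2 * η * (t * 0 + t ^ 2 * σ / κ * κ) =
        t ^ 2 * (a * t ^ 2 * σ ^ 2 + 2 * (t * β - η) * σ + γ) := by
      field_simp
      ring
    rw [hσ, mul_zero] at this
    linarith
  · rw [Real.sqrt_lt' hδ]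
    refine lt_of_le_of_lt ?_ hts
    have hσM2 : σ ^ 2 ≤ M ^ 2 := by nlinarith
    have hcoef : (t ^ 2 * σ / κ) ^ 2 ≤ (t ^ 2 * M / κ) ^ 2 := by
      rw [div_pow, div_pow, mul_pow, mul_pow]
      gcongr
    calc ∑ i, (t * u i + t ^ 2 * σ / κ * w i) ^ 2
        ≤ ∑ i, (2 * t ^ 2 * u i ^ 2 + 2 * (t ^ 2 * σ / κ) ^ 2 * w i ^ 2) :=
          sum_le_sum fun i _ => by nlinarith [sq_nonneg (t * u i - t ^ 2 * σ / κ * w i)]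
      _ = 2 * t ^ 2 * ∑ i, u i ^ 2 + 2 * (t ^ 2 * σ / κ) ^ 2 * ∑ i, w i ^ 2 := by
          rw [sum_add_distrib, mul_sum, mul_sum]
      _ ≤ _ := by gcongr

/-- A negative coordinate of a diagonal form yields a negative direction off any hyperplane. -/
lemma exists_neg_transversal {h p : ι → ℝ} {o : ι} (ho : h o < 0) (hp : p ≠ 0) :
    ∃ w : ι → ℝ, ∑ i, p i * w i ≠ 0 ∧ ∑ i, h i * w i ^ 2 < 0 := by
  classical
  by_cases hpo : p o = 0
  · have hp2 : ∑ i, p i * p i ≠ 0 := fun h0 => hp (dotProduct_self_eq_zero.1 h0)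
    set s := 1 + |∑ i, h i * p i ^ 2| / (-h o) with hs
    refine ⟨fun i => s * (Pi.single o (1 : ℝ) : ι → ℝ) i + 1 * p i, ?_, ?_⟩
    · rw [sum_mul_linComb]
      simpa [Pi.single_apply, hpo] using hp2
    · rw [sum_mul_linComb_sq]
      simp only [Pi.single_apply, ite_pow, one_pow, mul_ite, mul_one, mul_zero, ite_mul, zero_mul,
        sum_ite_eq', mem_univ, if_true, hpo, ne_eq, OfNat.ofNat_ne_zero, not_false_eq_true,
        zero_pow, one_mul, add_zero]
      have h1 : s * (-h o) = -h o + |∑ i, h i * p i ^ 2| := by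
        rw [hs]; field_simp [ho.ne]; ring
      have h2 : 1 ≤ s := by
        have : 0 ≤ |∑ i, h i * p i ^ 2| / (-h o) := div_nonneg (abs_nonneg _) (by linarith)
        linarith
      have h3 : s * (-h o) ≤ s ^ 2 * (-h o) :=
        mul_le_mul_of_nonneg_right (by nlinarith) (by linarith)
      linarith [le_abs_self (∑ i, h i * p i ^ 2)]
  · exact ⟨Pi.single o 1, by simpa [Pi.single_apply] using hpo, by simpa [Pi.single_apply] using ho⟩

lemma diag_of_tangent_pos {h p : ι → ℝ} {o : ι} (ho : h o < 0)
    (T : ∀ u : ι → ℝ, u ≠ 0 → ∑ i, p i * u i = 0 → 0 < ∑ i, h i * u i ^ 2) :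
    p o ≠ 0 ∧ (∀ j, j ≠ o → 0 < h j) ∧ ∑ i, p i ^ 2 / h i < 0 := by
  classical
  have hpo : p o ≠ 0 := by
    intro hpo
    have := T (Pi.single o 1) (by simp) (by simpa [Pi.single_apply] using hpo)
    simp [Pi.single_apply] at this
    linarith
  have hpos : ∀ j, j ≠ o → 0 < h j := by
    intro j hj
    have := T (fun i => p j * (Pi.single o (1 : ℝ) : ι → ℝ) i +
        (-p o) * (Pi.single j (1 : ℝ) : ι → ℝ) i) ?_ ?_
    · rw [sum_mul_linComb_sq] at this
      simp [Pi.single_apply, hj] at this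
      have h2 : 0 < p o ^ 2 := by positivity
      by_contra! hc
      nlinarith [sq_nonneg (p j)]
    · intro h0
      have := congrFun h0 j
      simp [hj, hpo] at this
    · rw [sum_mul_linComb]
      simp [Pi.single_apply]
      ring
  refine ⟨hpo, hpos, ?_⟩
  have hne : ∀ i, h i ≠ 0 := fun i => by
    by_cases hi : i = o
    · exact hi ▸ ho.ne
    · exact (hpos i hi).ne'
  by_contra! hq
  set q := ∑ i, p i ^ 2 / h i with hqd
  have e1 : ∑ i, p i * (p i / h i) = q := sum_congr rfl fun i _ => by ring
  have e2 : ∑ i, h i * (p i / h i) ^ 2 = q := sum_congr rfl fun i _ => by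
    have := hne i
    field_simp
  have e3 : ∑ i, h i * (Pi.single o (1 : ℝ) : ι → ℝ) i * (p i / h i) = p o := by
    have := hne o
    simp [Pi.single_apply]
    field_simp
  have hval : ∑ i, h i * (q * (Pi.single o (1 : ℝ) : ι → ℝ) i + (-p o) * (p i / h i)) ^ 2 =
      q ^ 2 * h o - q * p o ^ 2 := by
    rw [sum_mul_linComb_sq, e2, e3]
    simp [Pi.single_apply]
    ring
  have := T (fun i => q * (Pi.single o (1 : ℝ) : ι → ℝ) i + (-p o) * (p i / h i)) ?_ ?_
  · rw [hval] at this
    nlinarith [sq_nonneg q, sq_nonneg (p o), mul_nonneg hq (sq_nonneg (p o))]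
  · intro h0
    have hz : q ^ 2 * h o - q * p o ^ 2 = 0 := by
      rw [← hval]
      exact sum_eq_zero fun i _ => by
        have := congrFun h0 i
        simp only [Pi.zero_apply] at this
        rw [this]; ring
    have hq0 : q = 0 := by
      by_contra hq0
      have h2 : 0 < q ^ 2 := by positivity
      nlinarith [mul_nonneg hq (sq_nonneg (p o))]
    have := congrFun h0 o
    simp [hq0, hpo, hne o] at this
  · rw [sum_mul_linComb, e1]
    simp [Pi.single_apply]
    ring

/-- The second-order sufficient condition for a diagonal form with one negative entry. -/
lemma exists_local_of_diag {l p : ι → ℝ} {η : ℝ} {o : ι} (hη : 0 < η) (ho : l o + η < 0)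
    (hpos : ∀ j, j ≠ o → 0 < l j + η) (hpo : p o ≠ 0)
    (hq : ∑ i, p i ^ 2 / (l i + η) < 0) :
    ∃ δ > 0, ∀ d : ι → ℝ, ∑ i, l i * d i ^ 2 = 2 * η * ∑ i, p i * d i →
      √(∑ i, d i ^ 2) < δ → 0 ≤ ∑ i, (l i + η) * d i ^ 2 := by
  classical
  set s := univ.erase o with hs
  have hpos' : ∀ j ∈ s, 0 < l j + η := fun j hj => hpos j (ne_of_mem_erase hj)
  have split (f : ι → ℝ) : f o + ∑ i ∈ s, f i = ∑ i, f i := add_sum_erase _ _ (mem_univ o)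
  set H := -(l o + η) with hH
  have hHpos : 0 < H := by linarith
  set S := ∑ i ∈ s, p i ^ 2 / (l i + η) with hS
  have hS0 : 0 ≤ S := sum_nonneg fun i hi => div_nonneg (sq_nonneg _) (hpos' i hi).le
  have hSH : S * H < p o ^ 2 := by
    have h1 : p o ^ 2 / (l o + η) + S < 0 := by rwa [split fun i => p i ^ 2 / (l i + η)]
    have h2 : p o ^ 2 / (l o + η) * H = -p o ^ 2 := by
      rw [hH]; field_simp [ho.ne]
    nlinarith
  have hgap : √(S * H) < |p o| := by
    rw [← Real.sqrt_sq_eq_abs]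
    exact Real.sqrt_lt_sqrt (by positivity) hSH
  set C := ∑ i ∈ s, 1 / (l i + η) with hC
  have hC0 : 0 ≤ C := sum_nonneg fun i hi => (one_div_pos.2 (hpos' i hi)).le
  set L := ∑ i, |l i| with hL
  have hL0 : 0 ≤ L := sum_nonneg fun i _ => abs_nonneg _
  set k := L / (2 * η) * (1 + C * H) with hk
  have hk0 : 0 ≤ k := by positivity
  refine ⟨(|p o| - √(S * H)) / (k + 1), div_pos (by linarith) (by linarith), fun d hd hδ => ?_⟩
  by_contra! hneg
  set Q := ∑ i ∈ s, (l i + η) * d i ^ 2 with hQ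
  have hQ0 : 0 ≤ Q := sum_nonneg fun i hi => mul_nonneg (hpos' i hi).le (sq_nonneg _)
  have hQx : Q < H * d o ^ 2 := by
    have := split fun i => (l i + η) * d i ^ 2
    rw [hH]; linarith
  set D := ∑ i, d i ^ 2 with hD
  have hDx : d o ^ 2 ≤ D :=
    single_le_sum (f := fun i => d i ^ 2) (fun i _ => sq_nonneg _) (mem_univ o)
  have hDle : D ≤ (1 + C * H) * d o ^ 2 := by
    have h1 : ∑ i ∈ s, d i ^ 2 ≤ C * Q := by
      rw [hQ, mul_sum]
      refine sum_le_sum fun i hi => ?_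
      have h2 : 1 / (l i + η) ≤ C :=
        single_le_sum (f := fun i => 1 / (l i + η)) (fun j hj => (one_div_pos.2 (hpos' j hj)).le) hi
      have h3 := hpos' i hi
      calc d i ^ 2 = 1 / (l i + η) * ((l i + η) * d i ^ 2) := by field_simp
        _ ≤ C * ((l i + η) * d i ^ 2) := by gcongr
    have := split fun i => d i ^ 2
    nlinarith [mul_le_mul_of_nonneg_left hQx.le hC0]
  set B := ∑ i ∈ s, p i * d i with hB
  have hBS : B ^ 2 ≤ S * Q := sum_sq_le_sum_mul_sum_of_sq_le_mul s
    (fun i hi => div_nonneg (sq_nonneg _) (hpos' i hi).le)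
    (fun i hi => mul_nonneg (hpos' i hi).le (sq_nonneg _))
    (fun i hi => by have := hpos' i hi; exact le_of_eq (by field_simp))
  have hBle : |B| ≤ √(S * H) * |d o| := by
    rw [← Real.sqrt_sq_eq_abs, ← Real.sqrt_sq_eq_abs, ← Real.sqrt_mul (by positivity)]
    exact Real.sqrt_le_sqrt (by nlinarith [mul_le_mul_of_nonneg_left hQx.le hS0])
  set τ := ∑ i, p i * d i with hτ
  have hτle : |τ| ≤ k * d o ^ 2 := by
    have h1 : |∑ i, l i * d i ^ 2| ≤ L * D := by
      rw [hD, mul_sum]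
      refine (abs_sum_le_sum_abs _ _).trans (sum_le_sum fun i _ => ?_)
      rw [abs_mul, abs_of_nonneg (sq_nonneg (d i))]
      exact mul_le_mul_of_nonneg_right
        (single_le_sum (f := fun i => |l i|) (fun j _ => abs_nonneg _) (mem_univ i)) (sq_nonneg _)
    rw [hd, abs_mul, abs_of_pos (by positivity : (0 : ℝ) < 2 * η)] at h1
    calc |τ| = (2 * η * |τ|) / (2 * η) := by field_simp
      _ ≤ (L * ((1 + C * H) * d o ^ 2)) / (2 * η) := by
          exact div_le_div_of_nonneg_right (h1.trans (mul_le_mul_of_nonneg_left hDle hL0))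
            (by positivity)
      _ = k * d o ^ 2 := by rw [hk]; ring
  have hx0 : 0 < |d o| := abs_pos.2 fun h0 => by
    rw [h0] at hQx
    linarith
  have hmain : |p o| * |d o| ≤ (k * |d o| + √(S * H)) * |d o| := by
    have h1 : p o * d o = τ - B := by
      have := split fun i => p i * d i
      linarith
    calc |p o| * |d o| = |τ - B| := by rw [← abs_mul, h1]
      _ ≤ |τ| + |B| := abs_sub _ _
      _ ≤ k * d o ^ 2 + √(S * H) * |d o| := add_le_add hτle hBle
      _ = _ := by rw [← sq_abs (d o)]; ring
  have hmain' := le_of_mul_le_mul_right hmain hx0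
  have hxδ : |d o| < (|p o| - √(S * H)) / (k + 1) :=
    (Real.abs_le_sqrt hDx).trans_lt hδ
  rw [lt_div_iff₀ (by linarith)] at hxδ
  nlinarith

end DiagonalForms

section EigenCoordinates

variable {n : ℕ} {A : Matrix (Fin n) (Fin n) ℝ} {lam : Fin n → ℝ} {v : Fin n → Fin n → ℝ}

lemma dotProduct_eq_sum_coord
    (horth : ∀ i j : Fin n, v i ⬝ᵥ v j = if i = j then (1 : ℝ) else 0) (y z : Fin n → ℝ) :
    y ⬝ᵥ z = ∑ i, (v i ⬝ᵥ y) * (v i ⬝ᵥ z) := by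
  have h1 : (Matrix.of v) * (Matrix.of v)ᵀ = 1 := by
    ext i j
    rw [Matrix.mul_apply', Matrix.one_apply, ← horth i j]
    rfl
  have h2 : (Matrix.of v)ᵀ * (Matrix.of v) = 1 := mul_eq_one_comm.1 h1
  calc y ⬝ᵥ z = y ⬝ᵥ (((Matrix.of v)ᵀ * (Matrix.of v)) *ᵥ z) := by rw [h2, one_mulVec]
    _ = (Matrix.of v *ᵥ y) ⬝ᵥ (Matrix.of v *ᵥ z) := by
        rw [← mulVec_mulVec, dotProduct_mulVec, vecMul_transpose]
    _ = _ := rfl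

lemma coord_mulVec (hA : A.IsSymm) (heig : ∀ i : Fin n, A.mulVec (v i) = lam i • v i)
    (i : Fin n) (y : Fin n → ℝ) : v i ⬝ᵥ A *ᵥ y = lam i * (v i ⬝ᵥ y) := by
  rw [dotProduct_mulVec, ← mulVec_transpose, hA.eq, heig, smul_dotProduct, smul_eq_mul]

lemma coord_sum_smul
    (horth : ∀ i j : Fin n, v i ⬝ᵥ v j = if i = j then (1 : ℝ) else 0) (x : Fin n → ℝ)
    (j : Fin n) : v j ⬝ᵥ ∑ i, x i • v i = x j := by
  simp [dotProduct_sum, horth]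

lemma eq_iff_coord_eq
    (horth : ∀ i j : Fin n, v i ⬝ᵥ v j = if i = j then (1 : ℝ) else 0) {y z : Fin n → ℝ} :
    y = z ↔ ∀ i, v i ⬝ᵥ y = v i ⬝ᵥ z := by
  refine ⟨fun h i => by rw [h], fun h => sub_eq_zero.1 (dotProduct_self_eq_zero.1 ?_)⟩
  rw [dotProduct_eq_sum_coord horth]
  simp [dotProduct_sub, h]

lemma gq_eq_sum_coord (hA : A.IsSymm)
    (horth : ∀ i j : Fin n, v i ⬝ᵥ v j = if i = j then (1 : ℝ) else 0)
    (heig : ∀ i : Fin n, A.mulVec (v i) = lam i • v i) (b : Fin n → ℝ) (c : ℝ) (y : Fin n → ℝ) :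
    gq A b c y = ∑ i, (lam i * (v i ⬝ᵥ y) ^ 2 + 2 * ((v i ⬝ᵥ b) * (v i ⬝ᵥ y))) + c := by
  rw [gq, dotProduct_eq_sum_coord horth y, dotProduct_eq_sum_coord horth b, mul_sum,
    ← sum_add_distrib]
  congr 1
  refine sum_congr rfl fun i _ => ?_
  rw [coord_mulVec hA heig]
  ring

lemma stationary_iff_coord (hA : A.IsSymm)
    (horth : ∀ i j : Fin n, v i ⬝ᵥ v j = if i = j then (1 : ℝ) else 0)
    (heig : ∀ i : Fin n, A.mulVec (v i) = lam i • v i) {b y : Fin n → ℝ} {η : ℝ} (hη : 0 < η) :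
    ((1 : Matrix (Fin n) (Fin n) ℝ) + (1 / η) • A).mulVec y + (1 / η) • b = 0 ↔
      ∀ i, (lam i + η) * (v i ⬝ᵥ y) = -(v i ⬝ᵥ b) := by
  rw [eq_iff_coord_eq horth]
  refine forall_congr' fun i => ?_
  rw [add_mulVec, one_mulVec, smul_mulVec, dotProduct_add, dotProduct_add, dotProduct_smul,
    dotProduct_smul, coord_mulVec hA heig, dotProduct_zero]
  simp only [smul_eq_mul]
  constructor
  · intro h
    field_simp at h
    linarith
  · intro h
    field_simp
    linarith

/-- At a stationary point with multiplier `1 / η`, the constraint and the objective depend on the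
displacement `d`, in eigenvector coordinates, only through diagonal forms. -/
lemma isLNGMinPplus_iff_diag (hA : A.IsSymm)
    (horth : ∀ i j : Fin n, v i ⬝ᵥ v j = if i = j then (1 : ℝ) else 0)
    (heig : ∀ i : Fin n, A.mulVec (v i) = lam i • v i) {b ys : Fin n → ℝ} {c η : ℝ} (hη : 0 < η)
    (hst : ∀ i, (lam i + η) * (v i ⬝ᵥ ys) = -(v i ⬝ᵥ b)) :
    IsLNGMinPplus A b c ys ↔ gq A b c ys = 0 ∧
      (∃ δ > 0, ∀ d : Fin n → ℝ, ∑ i, lam i * d i ^ 2 = 2 * η * ∑ i, (v i ⬝ᵥ ys) * d i →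
        √(∑ i, d i ^ 2) < δ → 0 ≤ ∑ i, (lam i + η) * d i ^ 2) ∧
      ∃ d : Fin n → ℝ, ∑ i, lam i * d i ^ 2 = 2 * η * ∑ i, (v i ⬝ᵥ ys) * d i ∧
        ∑ i, (lam i + η) * d i ^ 2 < 0 := by
  have hg (y : Fin n → ℝ) : gq A b c y = gq A b c ys +
      (∑ i, lam i * (v i ⬝ᵥ (y - ys)) ^ 2 -
        2 * η * ∑ i, (v i ⬝ᵥ ys) * (v i ⬝ᵥ (y - ys))) := by
    rw [gq_eq_sum_coord hA horth heig, gq_eq_sum_coord hA horth heig, mul_sum,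
      ← sum_sub_distrib, add_right_comm, ← sum_add_distrib]
    congr 1
    refine sum_congr rfl fun i _ => ?_
    rw [dotProduct_sub]
    linear_combination (2 * (v i ⬝ᵥ y) - 2 * (v i ⬝ᵥ ys)) * hst i
  have hN (y : Fin n → ℝ) : η * (y ⬝ᵥ y - ys ⬝ᵥ ys) =
      ∑ i, (lam i + η) * (v i ⬝ᵥ (y - ys)) ^ 2 -
        (∑ i, lam i * (v i ⬝ᵥ (y - ys)) ^ 2 -
          2 * η * ∑ i, (v i ⬝ᵥ ys) * (v i ⬝ᵥ (y - ys))) := by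
    rw [dotProduct_eq_sum_coord horth y, dotProduct_eq_sum_coord horth ys, mul_sum,
      ← sum_sub_distrib, ← sum_sub_distrib, ← sum_sub_distrib, mul_sum]
    refine sum_congr rfl fun i _ => ?_
    rw [dotProduct_sub]
    ring
  have hnorm (y : Fin n → ℝ) : euclNorm y = √(∑ i, (v i ⬝ᵥ y) ^ 2) := by
    simp only [euclNorm, dotProduct_eq_sum_coord horth y, sq]
  have hle {y : Fin n → ℝ} (h : ∑ i, lam i * (v i ⬝ᵥ (y - ys)) ^ 2 =
      2 * η * ∑ i, (v i ⬝ᵥ ys) * (v i ⬝ᵥ (y - ys))) :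
      ys ⬝ᵥ ys ≤ y ⬝ᵥ y ↔ 0 ≤ ∑ i, (lam i + η) * (v i ⬝ᵥ (y - ys)) ^ 2 := by
    have := hN y
    rw [h, sub_self, sub_zero] at this
    rw [← this, mul_nonneg_iff_of_pos_left hη, sub_nonneg]
  have key (P : ℝ → Prop) (hgs : gq A b c ys = 0) :
      (∀ y : Fin n → ℝ, gq A b c y = 0 → P (euclNorm (y - ys)) → ys ⬝ᵥ ys ≤ y ⬝ᵥ y) ↔
      ∀ d : Fin n → ℝ, ∑ i, lam i * d i ^ 2 = 2 * η * ∑ i, (v i ⬝ᵥ ys) * d i →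
        P √(∑ i, d i ^ 2) → 0 ≤ ∑ i, (lam i + η) * d i ^ 2 := by
    constructor
    · intro h d hd hP
      have e (i : Fin n) : v i ⬝ᵥ ((ys + ∑ i, d i • v i) - ys) = d i := by
        rw [add_sub_cancel_left, coord_sum_smul horth]
      have h1 := h (ys + ∑ i, d i • v i)
      rw [hg, hgs, hnorm] at h1
      simp only [e] at h1
      have h2 := h1 (by linarith) hP
      rw [hle (by simpa only [e] using hd)] at h2
      simpa only [e] using h2
    · intro h y hy hP
      rw [hg, hgs, zero_add, sub_eq_zero] at hy
      exact (hle hy).2 (h _ hy (by rwa [hnorm] at hP))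
  rw [IsLNGMinPplus, and_assoc]
  refine and_congr_right fun hgs => and_congr ?_ ?_
  · exact exists_congr fun δ => and_congr_right fun _ => key (· < δ) hgs
  · have := key (fun _ => True) hgs
    simp only [forall_const] at this
    rw [this]
    push Not
    rfl

lemma eq_yOne_iff (horth : ∀ i j : Fin n, v i ⬝ᵥ v j = if i = j then (1 : ℝ) else 0)
    {b y : Fin n → ℝ} {η : ℝ} (hne : ∀ i, lam i + η ≠ 0) :
    y = yOne lam v b η ↔ ∀ i, (lam i + η) * (v i ⬝ᵥ y) = -(v i ⬝ᵥ b) := by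
  rw [eq_iff_coord_eq horth]
  refine forall_congr' fun i => ?_
  have := hne i
  rw [yOne, dotProduct_neg, coord_sum_smul horth, eq_comm, ← neg_div, div_eq_iff this, eq_comm,
    mul_comm]

lemma psiOne_eq_gq (hA : A.IsSymm)
    (horth : ∀ i j : Fin n, v i ⬝ᵥ v j = if i = j then (1 : ℝ) else 0)
    (heig : ∀ i : Fin n, A.mulVec (v i) = lam i • v i) {b y : Fin n → ℝ} {c η : ℝ}
    (hne : ∀ i, lam i + η ≠ 0) (hst : ∀ i, (lam i + η) * (v i ⬝ᵥ y) = -(v i ⬝ᵥ b)) :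
    psiOne lam v b c η = gq A b c y := by
  rw [psiOne, gq_eq_sum_coord hA horth heig, ← sum_sub_distrib]
  congr 1
  refine sum_congr rfl fun i _ => ?_
  have := hne i
  rw [show v i ⬝ᵥ b = -((lam i + η) * (v i ⬝ᵥ y)) by linarith [hst i]]
  field_simp
  ring

lemma psiOne'_eq_sum_coord {b y : Fin n → ℝ} {η : ℝ} (hne : ∀ i, lam i + η ≠ 0)
    (hst : ∀ i, (lam i + η) * (v i ⬝ᵥ y) = -(v i ⬝ᵥ b)) :
    psiOne' lam v b η = 2 * η * ∑ i, (v i ⬝ᵥ y) ^ 2 / (lam i + η) := by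
  rw [psiOne']
  congr 1
  refine sum_congr rfl fun i _ => ?_
  have := hne i
  rw [show v i ⬝ᵥ b = -((lam i + η) * (v i ⬝ᵥ y)) by linarith [hst i]]
  field_simp

end EigenCoordinates

theorem stmt13 {n : ℕ} (hn : 2 ≤ n)
    (A : Matrix (Fin n) (Fin n) ℝ) (hA : A.IsSymm)
    (b : Fin n → ℝ) (c : ℝ)
    (lam : Fin n → ℝ) (hmono : Monotone lam)
    (v : Fin n → Fin n → ℝ)
    (horth : ∀ i j : Fin n, v i ⬝ᵥ v j = if i = j then (1:ℝ) else 0)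
    (heig : ∀ i : Fin n, A.mulVec (v i) = lam i • v i)
    (ys : Fin n → ℝ) (ηs : ℝ) (hηs : 0 < ηs) :
    (IsLNGMinPplus A b c ys ∧
      ((1 : Matrix (Fin n) (Fin n) ℝ) + (1 / ηs) • A).mulVec ys + (1 / ηs) • b = 0) ↔
    (max (-(lam ⟨1, by omega⟩)) 0 < ηs ∧ ηs < -(lam ⟨0, by omega⟩) ∧
      v ⟨0, by omega⟩ ⬝ᵥ b ≠ 0 ∧
      ys = yOne lam v b ηs ∧
      psiOne lam v b c ηs = 0 ∧
      psiOne' lam v b ηs < 0) := by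
  set o : Fin n := ⟨0, by omega⟩ with ho
  set o' : Fin n := ⟨1, by omega⟩ with ho'
  have hne_of (h0 : lam o + ηs < 0) (hpos : ∀ j, j ≠ o → 0 < lam j + ηs) (i : Fin n) :
      lam i + ηs ≠ 0 := by
    by_cases hi : i = o
    · exact hi ▸ h0.ne
    · exact (hpos i hi).ne'
  constructor
  · rintro ⟨hmin, hst⟩
    rw [stationary_iff_coord hA horth heig hηs] at hst
    rw [isLNGMinPplus_iff_diag hA horth heig hηs hst] at hmin
    obtain ⟨hg, ⟨δ, hδ, hloc⟩, d, hd, hdneg⟩ := hmin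
    have h0 : lam o + ηs < 0 := by
      by_contra! h
      refine hdneg.not_ge (sum_nonneg fun i _ => mul_nonneg ?_ (sq_nonneg _))
      linarith [hmono (show o ≤ i from Nat.zero_le _)]
    have hp : (fun i => v i ⬝ᵥ ys) ≠ 0 := by
      intro hp
      have hp' (i : Fin n) : v i ⬝ᵥ ys = 0 := congrFun hp i
      simp only [hp', zero_mul, sum_const_zero, mul_zero] at hd
      rw [sum_add_const_mul_sq, hd, zero_add] at hdneg
      exact hdneg.not_ge (mul_nonneg hηs.le (sum_nonneg fun i _ => sq_nonneg _))
    obtain ⟨w, hw, hW⟩ := exists_neg_transversal (h := fun i => lam i + ηs) h0 hp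
    obtain ⟨hpo, hpos, hq⟩ := diag_of_tangent_pos (h := fun i => lam i + ηs)
      (p := fun i => v i ⬝ᵥ ys) h0
      fun u hu hpu => tangent_pos_of_local hηs hδ hloc hw hW hu hpu
    have hne := hne_of h0 hpos
    have h1 := hpos o' (by simp [ho, ho'])
    refine ⟨max_lt (by linarith) hηs, by linarith, fun hr => ?_, (eq_yOne_iff horth hne).2 hst,
      (psiOne_eq_gq hA horth heig hne hst).trans hg, ?_⟩
    · have := hst o
      rw [hr, neg_zero] at this
      exact mul_ne_zero h0.ne hpo this
    · rw [psiOne'_eq_sum_coord hne hst]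
      exact mul_neg_of_pos_of_neg (by positivity) hq
  · rintro ⟨hmax, hlt, hr, hys, hpsi, hpsi'⟩
    have h0 : lam o + ηs < 0 := by linarith
    have hpos (j : Fin n) (hj : j ≠ o) : 0 < lam j + ηs := by
      have h1 : o' ≤ j := Nat.one_le_iff_ne_zero.2 fun h => hj (Fin.ext h)
      linarith [hmono h1, (max_lt_iff.1 hmax).1]
    have hne := hne_of h0 hpos
    have hst := (eq_yOne_iff horth hne).1 hys
    rw [psiOne_eq_gq hA horth heig hne hst] at hpsi
    rw [psiOne'_eq_sum_coord hne hst] at hpsi'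
    have hq : ∑ i, (v i ⬝ᵥ ys) ^ 2 / (lam i + ηs) < 0 :=
      (pos_iff_neg_of_mul_neg hpsi').1 (by positivity)
    have hpo : v o ⬝ᵥ ys ≠ 0 := fun hp => hr (by
      have := hst o
      rw [hp] at this
      linarith)
    refine ⟨(isLNGMinPplus_iff_diag hA horth heig hηs hst).2 ⟨hpsi,
      exists_local_of_diag (p := fun i => v i ⬝ᵥ ys) hηs h0 hpos hpo hq,
      Pi.single o (2 * ηs * (v o ⬝ᵥ ys) / lam o), ?_, ?_⟩,
      (stationary_iff_coord hA horth heig hηs).2 hst⟩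
    · have : lam o ≠ 0 := by linarith
      simp [Pi.single_apply]
      field_simp
    · have h2 : lam o ≠ 0 := by linarith
      have h3 : 0 < (2 * ηs * (v o ⬝ᵥ ys) / lam o) ^ 2 := by positivity
      simpa [Pi.single_apply] using mul_neg_of_neg_of_pos h0 h3
end
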